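/- arXiv:1401.4774 — 7 statements merged into one kernel-verified Lean document; each statement's English description precedes it below -/
import Mathlib

section
/- Let 𝒜 : E → H be a linear operator between finite-dimensional real inner product spaces and Q ⊆ H a closed convex set. Then F is a face of the preimage 𝒜⁻¹(Q) if and only if F has the form 𝒜⁻¹(M) for some face M of Q. Moreover, if F is a face of 𝒜⁻¹(Q), then it can be written as 𝒜⁻¹(M), where M is the minimal face of Q containing 𝒜(F). -/
noncomputable section

open Set

/-- A face of a convex set `Q`: a convex subset `F ⊆ Q` such that every closed segment in `Q`
whose relative interior meets `F` lies entirely in `F`. -/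
def IsFace {V : Type*} [AddCommGroup V] [Module ℝ V] (Q F : Set V) : Prop :=
  F ⊆ Q ∧ Convex ℝ F ∧
    ∀ ⦃x⦄, x ∈ Q → ∀ ⦃y⦄, y ∈ Q → ∀ ⦃t : ℝ⦄, 0 < t → t < 1 →
      (1 - t) • x + t • y ∈ F → x ∈ F ∧ y ∈ F

/-- The points of `Q` that can be prolonged, within `Q`, beyond some point of `C`. For convex
`C ⊆ Q` this is a face of `Q` containing `C`. -/
def faceHull {V : Type*} [AddCommGroup V] [Module ℝ V] (Q C : Set V) : Set V :=
  {x | x ∈ Q ∧ ∃ c ∈ C, ∃ ε : ℝ, 0 < ε ∧ c + ε • (c - x) ∈ Q}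

section FaceHull

variable {V W : Type*} [AddCommGroup V] [Module ℝ V] [AddCommGroup W] [Module ℝ W]

theorem Convex.add_smul_sub_mem_of_le {Q : Set V} (hQ : Convex ℝ Q) {c x : V} {δ ε : ℝ}
    (hc : c ∈ Q) (hε : 0 < ε) (h : c + ε • (c - x) ∈ Q) (hδ : 0 < δ) (hδε : δ ≤ ε) :
    c + δ • (c - x) ∈ Q := by
  have key := hQ.add_smul_sub_mem hc h (t := δ / ε) ⟨by positivity, (div_le_one hε).2 hδε⟩
  rwa [add_sub_cancel_left, smul_smul, div_mul_cancel₀ _ hε.ne'] at key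

theorem subset_faceHull {Q C : Set V} (hCQ : C ⊆ Q) : C ⊆ faceHull Q C :=
  fun c hc ↦ ⟨hCQ hc, c, hc, 1, one_pos, by simpa using hCQ hc⟩

theorem convex_faceHull {Q C : Set V} (hQ : Convex ℝ Q) (hC : Convex ℝ C) (hCQ : C ⊆ Q) :
    Convex ℝ (faceHull Q C) := by
  rintro x ⟨hx, c, hc, ε, hε, hcx⟩ y ⟨hy, d, hd, δ, hδ, hdy⟩ a b ha hb hab
  have hmin : 0 < min ε δ := lt_min hε hδ
  refine ⟨hQ hx hy ha hb hab, a • c + b • d, hC hc hd ha hb hab, min ε δ, hmin, ?_⟩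
  have key := hQ (hQ.add_smul_sub_mem_of_le (hCQ hc) hε hcx hmin (min_le_left _ _))
    (hQ.add_smul_sub_mem_of_le (hCQ hd) hδ hdy hmin (min_le_right _ _)) ha hb hab
  convert key using 1
  module

theorem left_mem_faceHull {Q C : Set V} (hQ : Convex ℝ Q) {x y : V} (hx : x ∈ Q) (hy : y ∈ Q)
    {t : ℝ} (ht₀ : 0 < t) (ht₁ : t < 1) (h : (1 - t) • x + t • y ∈ faceHull Q C) :
    x ∈ faceHull Q C := by
  obtain ⟨-, c, hc, ε, hε, hw⟩ := h
  have ht : 0 < 1 - t := sub_pos.2 ht₁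
  have hpos : 0 < 1 + ε * t := by positivity
  refine ⟨hx, c, hc, ε * (1 - t) / (1 + ε * t), by positivity, ?_⟩
  have key := hQ hw hy (a := 1 / (1 + ε * t)) (b := ε * t / (1 + ε * t))
    (by positivity) (by positivity) (by field_simp)
  convert key using 1
  match_scalars <;> field_simp <;> ring

theorem isFace_faceHull {Q C : Set V} (hQ : Convex ℝ Q) (hC : Convex ℝ C) (hCQ : C ⊆ Q) :
    IsFace Q (faceHull Q C) := by
  refine ⟨fun _ h ↦ h.1, convex_faceHull hQ hC hCQ, fun x hx y hy t ht₀ ht₁ h ↦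
    ⟨left_mem_faceHull hQ hx hy ht₀ ht₁ h, left_mem_faceHull hQ hy hx (sub_pos.2 ht₁)
      (sub_lt_self 1 ht₀) ?_⟩⟩
  rwa [sub_sub_cancel, add_comm]

theorem IsFace.preimage {Q M : Set W} (hM : IsFace Q M) (A : V →ₗ[ℝ] W) :
    IsFace (A ⁻¹' Q) (A ⁻¹' M) := by
  obtain ⟨hMQ, hMconv, hface⟩ := hM
  refine ⟨preimage_mono hMQ, hMconv.linear_preimage A, fun x hx y hy t ht₀ ht₁ h ↦ ?_⟩
  exact hface hx hy ht₀ ht₁ (by simpa using h)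

theorem IsFace.preimage_faceHull_subset {Q : Set W} {A : V →ₗ[ℝ] W} {F : Set V}
    (hF : IsFace (A ⁻¹' Q) F) : A ⁻¹' faceHull Q (A '' F) ⊆ F := by
  rintro x ⟨hx, _, ⟨f, hf, rfl⟩, ε, hε, h⟩
  refine (hF.2.2 hx (y := f + ε • (f - x)) (by simpa using h) (t := 1 / (1 + ε))
    (by positivity) ((div_lt_one (by positivity)).2 (by linarith)) ?_).1
  convert hf using 1
  match_scalars <;> field_simp <;> ring

end FaceHull

/-- **Faces of preimages of sets.**  `F` is a face of `𝒜⁻¹(Q)` iff `F = 𝒜⁻¹(M)` for some face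
`M` of `Q`; moreover any face `F` of `𝒜⁻¹(Q)` equals `𝒜⁻¹(M)` where `M` is the minimal face of
`Q` containing `𝒜(F)`. -/
theorem stmt1 {E H : Type*} [NormedAddCommGroup E] [InnerProductSpace ℝ E]
    [FiniteDimensional ℝ E] [NormedAddCommGroup H] [InnerProductSpace ℝ H]
    [FiniteDimensional ℝ H] (A : E →ₗ[ℝ] H) (Q : Set H)
    (hQclosed : IsClosed Q) (hQconv : Convex ℝ Q) :
    (∀ F : Set E, IsFace (A ⁻¹' Q) F ↔ ∃ M : Set H, IsFace Q M ∧ F = A ⁻¹' M) ∧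
    ∀ F : Set E, IsFace (A ⁻¹' Q) F →
      ∀ M : Set H,
        (IsFace Q M ∧ A '' F ⊆ M ∧ ∀ M' : Set H, IsFace Q M' → A '' F ⊆ M' → M ⊆ M') →
        F = A ⁻¹' M := by
  have hsub {F : Set E} (hF : IsFace (A ⁻¹' Q) F) : A '' F ⊆ Q := image_subset_iff.2 hF.1
  have hface {F : Set E} (hF : IsFace (A ⁻¹' Q) F) : IsFace Q (faceHull Q (A '' F)) :=
    isFace_faceHull hQconv (hF.2.1.linear_image A) (hsub hF)
  refine ⟨fun F ↦ ⟨fun hF ↦ ⟨faceHull Q (A '' F), hface hF, ?_⟩, ?_⟩, ?_⟩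
  · exact (image_subset_iff.1 (subset_faceHull (hsub hF))).antisymm hF.preimage_faceHull_subset
  · rintro ⟨M, hM, rfl⟩
    exact hM.preimage A
  · rintro F hF M ⟨-, hFM, hmin⟩
    exact (image_subset_iff.1 hFM).antisymm <| (preimage_mono <|
      hmin _ (hface hF) (subset_faceHull (hsub hF))).trans hF.preimage_faceHull_subset
end
end

section
/- Let f : E → ℝ ∪ {+∞} be a proper lower-semicontinuous convex function on a finite-dimensional real inner product space E, and let x̄ ∈ E. Then for any vector v in the relative interior of the subdifferential ∂f(x̄), the set ∂f*(v) is a minimal exposed face of f at x̄. -/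
noncomputable section

open Set
open scoped RealInnerProductSpace

/-- The epigraph of `f : E → ℝ ∪ {+∞}`. -/
def Epi {E : Type*} (f : E → EReal) : Set (E × ℝ) := {p | f p.1 ≤ (p.2 : EReal)}

/-- The convex subdifferential of `f` at `x`. -/
def Subdiff {E : Type*} [NormedAddCommGroup E] [InnerProductSpace ℝ E]
    (f : E → EReal) (x : E) : Set E :=
  {v | ∀ y, f x + ((⟪v, y - x⟫ : ℝ) : EReal) ≤ f y}

/-- The Fenchel conjugate of `f`. -/
def Conj {E : Type*} [NormedAddCommGroup E] [InnerProductSpace ℝ E]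
    (f : E → EReal) (u : E) : EReal :=
  ⨆ x, (((⟪u, x⟫ : ℝ) : EReal) - f x)

/-- `F` is an exposed face of the function `f` with exposing vector `v`:
`F = argmin_x (f x − ⟨v, x⟩)`. -/
def IsFnExposedFace {E : Type*} [NormedAddCommGroup E] [InnerProductSpace ℝ E]
    (f : E → EReal) (F : Set E) (v : E) : Prop :=
  F = {x | ∀ y, f x - ((⟪v, x⟫ : ℝ) : EReal) ≤ f y - ((⟪v, y⟫ : ℝ) : EReal)}

/-- Minimal exposed face of the function `f` at `x`. -/
def IsMinFnExposedFaceAt {E : Type*} [NormedAddCommGroup E] [InnerProductSpace ℝ E]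
    (f : E → EReal) (F : Set E) (x : E) : Prop :=
  (∃ v, IsFnExposedFace f F v) ∧ x ∈ F ∧
    ∀ F' : Set E, (∃ v, IsFnExposedFace f F' v) → x ∈ F' → F ⊆ F'

section

variable {E : Type*} [NormedAddCommGroup E] [InnerProductSpace ℝ E] {f : E → EReal}

theorem EReal.add_coe_sub_le_iff (a b : EReal) (p q : ℝ) :
    a + ((q - p : ℝ) : EReal) ≤ b ↔ a - (p : EReal) ≤ b - (q : EReal) := by
  induction a using EReal.rec <;> induction b using EReal.rec <;>
    first
    | norm_cast; constructor <;> intro h <;> linarith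
    | simp [← EReal.coe_add, ← EReal.coe_sub]

/-- The points exposed by `v` are those at which `v` is a subgradient. -/
theorem forall_sub_inner_le_iff_mem_subdiff (f : E → EReal) (v x : E) :
    (∀ y, f x - ((⟪v, x⟫ : ℝ) : EReal) ≤ f y - ((⟪v, y⟫ : ℝ) : EReal)) ↔ v ∈ Subdiff f x := by
  refine forall_congr' fun y => ?_
  rw [← EReal.add_coe_sub_le_iff, inner_sub_right]

theorem exists_eq_coe_of_mem_subdiff (hproper : (∀ x, f x ≠ ⊥) ∧ ∃ x, f x ≠ ⊤) {x v : E}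
    (hv : v ∈ Subdiff f x) : ∃ r : ℝ, f x = r := by
  obtain ⟨hbot, y, hy⟩ := hproper
  refine ⟨(f x).toReal, (EReal.coe_toReal (fun htop => hy ?_) (hbot x)).symm⟩
  simpa [htop] using hv y

theorem mem_subdiff_iff_of_eq_coe {x v : E} {r : ℝ} (hr : f x = r) :
    v ∈ Subdiff f x ↔ ∀ y (t : ℝ), f y ≤ t → r + ⟪v, y - x⟫ ≤ t := by
  refine forall_congr' fun y => ?_
  rw [hr, ← EReal.coe_add]
  refine ⟨fun h t ht => EReal.coe_le_coe_iff.1 (h.trans ht), fun h => ?_⟩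
  exact EReal.le_of_forall_lt_iff_le.1 fun t ht => EReal.coe_le_coe_iff.2 (h t ht.le)

theorem conj_le_coe_iff (f : E → EReal) (u : E) (m : ℝ) :
    Conj f u ≤ m ↔ ∀ y (t : ℝ), f y ≤ t → ⟪u, y⟫ - t ≤ m := by
  refine iSup_le_iff.trans (forall_congr' fun y => ?_)
  constructor
  · intro h t ht
    have := (EReal.sub_le_sub le_rfl ht).trans h
    exact_mod_cast this
  · intro h
    generalize f y = a at h
    induction a using EReal.rec with
    | bot =>
      have := h (⟪u, y⟫ - m - 1) bot_le
      linarith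
    | coe a => exact_mod_cast h a le_rfl
    | top => simp

theorem conj_eq_coe_of_mem_subdiff {x v : E} {r : ℝ} (hr : f x = r) (hv : v ∈ Subdiff f x) :
    Conj f v = ((⟪v, x⟫ - r : ℝ) : EReal) := by
  refine le_antisymm ((conj_le_coe_iff f v _).2 fun y t ht => ?_) ?_
  · have := (mem_subdiff_iff_of_eq_coe hr).1 hv y t ht
    rw [inner_sub_right] at this
    linarith
  · rw [EReal.coe_sub, ← hr]
    exact le_iSup (fun x => ((⟪v, x⟫ : ℝ) : EReal) - f x) x

theorem mem_subdiff_conj_of_mem_subdiff (hproper : (∀ x, f x ≠ ⊥) ∧ ∃ x, f x ≠ ⊤) {x v : E}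
    (hv : v ∈ Subdiff f x) : x ∈ Subdiff (Conj f) v := by
  obtain ⟨r, hr⟩ := exists_eq_coe_of_mem_subdiff hproper hv
  intro u
  have hle : ((⟪u, x⟫ : ℝ) : EReal) - f x ≤ Conj f u :=
    le_iSup (fun x => ((⟪u, x⟫ : ℝ) : EReal) - f x) x
  refine le_trans (le_of_eq ?_) hle
  rw [conj_eq_coe_of_mem_subdiff hr hv, hr, ← EReal.coe_add, ← EReal.coe_sub, inner_sub_right,
    real_inner_comm v x, real_inner_comm u x]
  congr 1
  ring

theorem isClosed_epi {X : Type*} [TopologicalSpace X] {f : X → EReal}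
    (hlsc : LowerSemicontinuous f) :
    IsClosed (Epi f) :=
  hlsc.isClosed_epigraph.preimage
    (continuous_fst.prodMk (continuous_coe_real_ereal.comp continuous_snd))

/-- A closed convex function is bounded above at `x` by the affine bound that a subgradient `x` of
its conjugate provides. -/
theorem le_inner_sub_of_mem_subdiff_conj [CompleteSpace E] (hne : (Epi f).Nonempty)
    (hlsc : LowerSemicontinuous f) (hconv : Convex ℝ (Epi f)) {x v : E} {m : ℝ}
    (hm : Conj f v = m) (hx : x ∈ Subdiff (Conj f) v) :
    f x ≤ ((⟪v, x⟫ - m : ℝ) : EReal) := by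
  by_contra hlt
  obtain ⟨φ, c, hφ, hc⟩ := geometric_hahn_banach_closed_point hconv (isClosed_epi hlsc)
    (x := (x, ⟪v, x⟫ - m)) hlt
  obtain ⟨a, ha⟩ : ∃ a : E, ∀ y, φ (y, 0) = ⟪a, y⟫ :=
    ⟨(InnerProductSpace.toDual ℝ E).symm (φ.comp (ContinuousLinearMap.inl ℝ E ℝ)), by simp⟩
  set s : ℝ := φ (0, 1)
  have hdecomp : ∀ y t, φ (y, t) = ⟪a, y⟫ + s * t := by
    intro y t
    have : ((y, t) : E × ℝ) = (y, 0) + t • (0, 1) := by simp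
    rw [this, map_add, map_smul, ha, smul_eq_mul, mul_comm]
  have hepi : ∀ y (t : ℝ), f y ≤ t → ⟪a, y⟫ + s * t < c := fun y t ht =>
    hdecomp y t ▸ hφ (y, t) ht
  rw [hdecomp] at hc
  have hconj := (conj_le_coe_iff f v m).1 hm.le
  have hgrow : ∀ u (b : ℝ), Conj f u ≤ b → m + ⟪u, x⟫ - ⟪v, x⟫ ≤ b := by
    intro u b hb
    have := (hx u).trans hb
    rw [hm, ← EReal.coe_add, EReal.coe_le_coe_iff, inner_sub_right, real_inner_comm u x,
      real_inner_comm v x] at this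
    linarith
  have hs0 : s ≤ 0 := by
    by_contra! hpos
    obtain ⟨⟨y, t⟩, hyt⟩ := hne
    have h := hepi y (max t ((c - ⟪a, y⟫) / s))
      (le_trans hyt (EReal.coe_le_coe_iff.2 (le_max_left _ _)))
    have h' := mul_le_mul_of_nonneg_left (le_max_right t ((c - ⟪a, y⟫) / s)) hpos.le
    rw [mul_div_cancel₀ _ hpos.ne'] at h'
    linarith
  rcases hs0.lt_or_eq with hneg | hzero
  · have hk : 0 < (-s)⁻¹ := inv_pos.2 (neg_pos.2 hneg)
    have hks : (-s)⁻¹ * s = -1 := by rw [inv_neg, neg_mul, inv_mul_cancel₀ hneg.ne]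
    have h := hgrow ((-s)⁻¹ • a) ((-s)⁻¹ * c) <| (conj_le_coe_iff f _ _).2 fun y t ht => by
      rw [real_inner_smul_left]
      have h' := mul_lt_mul_of_pos_left (hepi y t ht) hk
      rw [mul_add, ← mul_assoc, hks] at h'
      linarith
    rw [real_inner_smul_left] at h
    have h' := mul_lt_mul_of_pos_left hc hk
    rw [mul_add, ← mul_assoc, hks] at h'
    linarith
  · rw [hzero] at hc hepi
    have h := hgrow (v + a) (m + c) <| (conj_le_coe_iff f _ _).2 fun y t ht => by
      rw [inner_add_left]
      linarith [hepi y t ht, hconj y t ht]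
    rw [inner_add_left] at h
    linarith

theorem mem_subdiff_conj_iff [CompleteSpace E] (hproper : (∀ x, f x ≠ ⊥) ∧ ∃ x, f x ≠ ⊤)
    (hlsc : LowerSemicontinuous f) (hconv : Convex ℝ (Epi f)) {x₀ x v : E}
    (hv : v ∈ Subdiff f x₀) : x ∈ Subdiff (Conj f) v ↔ v ∈ Subdiff f x := by
  refine ⟨fun hx => ?_, mem_subdiff_conj_of_mem_subdiff hproper⟩
  obtain ⟨r, hr⟩ := exists_eq_coe_of_mem_subdiff hproper hv
  have hm := conj_eq_coe_of_mem_subdiff hr hv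
  have hle := le_inner_sub_of_mem_subdiff_conj ⟨(x₀, r), hr.le⟩ hlsc hconv hm hx
  have hq : f x = (f x).toReal :=
    (EReal.coe_toReal (ne_top_of_le_ne_top (EReal.coe_ne_top _) hle) (hproper.1 x)).symm
  refine (mem_subdiff_iff_of_eq_coe hq).2 fun y t ht => ?_
  rw [hq, EReal.coe_le_coe_iff] at hle
  have := (conj_le_coe_iff f v _).1 hm.le y t ht
  rw [inner_sub_right]
  linarith

/-- Segments of a set ending at a relative interior point can be prolonged past that point. -/
theorem exists_add_smul_sub_mem_of_mem_intrinsicInterior {s : Set E} {v w : E}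
    (hv : v ∈ intrinsicInterior ℝ s) (hw : w ∈ s) :
    ∃ ε : ℝ, 0 < ε ∧ v + ε • (v - w) ∈ s := by
  obtain ⟨v', hv', rfl⟩ := hv
  have hmem : ∀ t : ℝ, AffineMap.lineMap (v' : E) w t ∈ affineSpan ℝ s := fun t =>
    AffineMap.lineMap_mem t v'.2 (subset_affineSpan ℝ s hw)
  let γ : ℝ → affineSpan ℝ s := fun t => ⟨AffineMap.lineMap (v' : E) w t, hmem t⟩
  have hγ : Continuous γ := AffineMap.lineMap_continuous.subtype_mk hmem
  have hγ0 : γ 0 = v' := Subtype.ext (AffineMap.lineMap_apply_zero _ _)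
  have hnhds : γ ⁻¹' ((↑) ⁻¹' s) ∈ nhds (0 : ℝ) :=
    hγ.continuousAt.preimage_mem_nhds (hγ0 ▸ mem_interior_iff_mem_nhds.1 hv')
  obtain ⟨δ, hδ, hball⟩ := Metric.mem_nhds_iff.1 hnhds
  refine ⟨δ / 2, half_pos hδ, ?_⟩
  have hin : (-(δ / 2)) ∈ Metric.ball (0 : ℝ) δ := by
    rw [mem_ball_zero_iff, norm_neg, Real.norm_of_nonneg (half_pos hδ).le]
    exact half_lt_self hδ
  have h : AffineMap.lineMap (v' : E) w (-(δ / 2)) ∈ s := hball hin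
  rw [AffineMap.lineMap_apply_module'] at h
  convert h using 1
  module

/-- A point whose subdifferential contains a relative interior point of `Subdiff f x₀` has all of
`Subdiff f x₀` in its subdifferential. -/
theorem mem_subdiff_of_mem_intrinsicInterior (hproper : (∀ x, f x ≠ ⊥) ∧ ∃ x, f x ≠ ⊤)
    {x₀ x v w : E} (hv : v ∈ intrinsicInterior ℝ (Subdiff f x₀)) (hx : v ∈ Subdiff f x)
    (hw : w ∈ Subdiff f x₀) : w ∈ Subdiff f x := by
  obtain ⟨r, hr⟩ := exists_eq_coe_of_mem_subdiff hproper hw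
  obtain ⟨q, hq⟩ := exists_eq_coe_of_mem_subdiff hproper hx
  obtain ⟨ε, hε, hmem⟩ := exists_add_smul_sub_mem_of_mem_intrinsicInterior hv hw
  have hprolong := (mem_subdiff_iff_of_eq_coe hr).1 hmem x q hq.le
  have hback := (mem_subdiff_iff_of_eq_coe hq).1 hx x₀ r hr.le
  have hw' := (mem_subdiff_iff_of_eq_coe hr).1 hw
  rw [inner_add_left, real_inner_smul_left, inner_sub_left] at hprolong
  rw [← neg_sub, inner_neg_right] at hback
  have hle : ⟪v, x - x₀⟫ - ⟪w, x - x₀⟫ ≤ 0 := by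
    by_contra! hpos
    linarith [mul_pos hε hpos]
  refine (mem_subdiff_iff_of_eq_coe hq).2 fun y t ht => ?_
  have hy := hw' y t ht
  have hsplit : ⟪w, y - x₀⟫ = ⟪w, y - x⟫ + ⟪w, x - x₀⟫ := by
    rw [← inner_add_right, sub_add_sub_cancel]
  linarith

end

/-- **Minimal exposed faces of functions.**  For any `v` in the relative interior of `∂f(xbar)`,
the set `∂f*(v)` is a minimal exposed face of `f` at `xbar`. -/
theorem stmt7 {E : Type*} [NormedAddCommGroup E] [InnerProductSpace ℝ E]
    [FiniteDimensional ℝ E] (f : E → EReal)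
    (hproper : (∀ x, f x ≠ ⊥) ∧ ∃ x, f x ≠ ⊤)
    (hlsc : LowerSemicontinuous f) (hconv : Convex ℝ (Epi f)) (xbar : E) :
    ∀ v ∈ intrinsicInterior ℝ (Subdiff f xbar),
      IsMinFnExposedFaceAt f (Subdiff (Conj f) v) xbar := by
  intro v hv
  have : CompleteSpace E := FiniteDimensional.complete ℝ E
  have hv₀ : v ∈ Subdiff f xbar := intrinsicInterior_subset hv
  refine ⟨⟨v, ?_⟩, mem_subdiff_conj_of_mem_subdiff hproper hv₀, ?_⟩
  · ext x
    exact (mem_subdiff_conj_iff hproper hlsc hconv hv₀).trans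
      (forall_sub_inner_le_iff_mem_subdiff f v x).symm
  · rintro _ ⟨w, rfl⟩ hw x hx
    rw [mem_ofPred_eq, forall_sub_inner_le_iff_mem_subdiff] at hw ⊢
    exact mem_subdiff_of_mem_intrinsicInterior hproper hv
      ((mem_subdiff_conj_iff hproper hlsc hconv hv₀).1 hx) hw
end
end

section
/- Let f : E → ℝ be a continuous convex function on a finite-dimensional real inner product space E and r ∈ ℝ. Then: (1) if F is an exposed face of f with exposing vector v and F intersects the level set [f = r], then F ∩ [f = r] is an exposed face of the sublevel set [f ≤ r] with exposing vector v. -/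
noncomputable section

open Set
open scoped RealInnerProductSpace

/-- **Exposed faces of sublevel sets.**  If `F` is an exposed face of the continuous convex
function `f` with exposing vector `v`, and `F` meets `[f = r]`, then `F ∩ [f = r]` is an
exposed face of `[f ≤ r]` with exposing vector `v`. -/
theorem stmt11 {E : Type*} [NormedAddCommGroup E] [InnerProductSpace ℝ E]
    [FiniteDimensional ℝ E] (f : E → ℝ) (hcont : Continuous f)
    (hconv : ConvexOn ℝ univ f) (r : ℝ) (F : Set E) (v : E)
    (hF : F = {x | ∀ y, f x - ⟪v, x⟫ ≤ f y - ⟪v, y⟫})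
    (hFr : (F ∩ {x | f x = r}).Nonempty) :
    F ∩ {x | f x = r} =
      {x | f x ≤ r ∧ ∀ y, f y ≤ r → ⟪v, y⟫ ≤ ⟪v, x⟫} := by
  subst hF
  obtain ⟨z, hz, hzr⟩ := hFr
  simp only [mem_ofPred_eq] at hz hzr
  ext x
  simp only [mem_inter_iff, mem_ofPred_eq]
  constructor
  · rintro ⟨hx, hxr⟩
    exact ⟨hxr.le, fun y hy => by linarith [hx y]⟩
  · rintro ⟨hxr, hx⟩
    have hzx := hz x
    have hvz := hx z hzr.le
    exact ⟨fun y => by linarith [hz y], by linarith⟩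
end
end

section
/- Let Q₁ and Q₂ be compact convex sets containing the origin in their interiors, in a finite-dimensional real inner product space E. Then the sum of the gauges γ_{Q₁} + γ_{Q₂} equals the gauge of the set (Q₁° + Q₂°)°, where Q° := {v : ⟨v,x⟩ ≤ 1 for all x ∈ Q} denotes the polar set. Moreover, if Q₁ and Q₂ are facially exposed, then the set (Q₁° + Q₂°)° is facially exposed as well. -/
noncomputable section

open Set
open scoped RealInnerProductSpace Pointwise

/-- The polar set `Q° = {v : ⟨v, x⟩ ≤ 1 for all x ∈ Q}`. -/
def PolarSet {E : Type*} [NormedAddCommGroup E] [InnerProductSpace ℝ E] (Q : Set E) : Set E :=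
  {v | ∀ x ∈ Q, ⟪x, v⟫ ≤ 1}

/-- `Q` is facially exposed: every (nonempty) face of `Q` is an exposed face. -/
def FaciallyExposed {E : Type*} [NormedAddCommGroup E] [InnerProductSpace ℝ E]
    (Q : Set E) : Prop :=
  ∀ F : Set E, IsFace Q F → F.Nonempty →
    ∃ v : E, F = {x ∈ Q | ∀ y ∈ Q, ⟪v, y⟫ ≤ ⟪v, x⟫}

/-- A sublinear function that is positive away from the origin. -/
structure IsPositiveSublinear {E : Type*} [AddCommGroup E] [Module ℝ E] (γ : E → ℝ) : Prop where
  add_le : ∀ x y, γ (x + y) ≤ γ x + γ y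
  smul : ∀ c : ℝ, 0 ≤ c → ∀ x, γ (c • x) = c * γ x
  pos : ∀ x, x ≠ 0 → 0 < γ x

namespace IsPositiveSublinear

section Module

variable {E : Type*} [AddCommGroup E] [Module ℝ E] {γ γ' : E → ℝ}

theorem zero (h : IsPositiveSublinear γ) : γ 0 = 0 := by
  simpa using h.smul 0 le_rfl 0

theorem nonneg (h : IsPositiveSublinear γ) (x : E) : 0 ≤ γ x := by
  by_cases hx : x = 0
  · rw [hx, h.zero]
  · exact (h.pos x hx).le

theorem add (h : IsPositiveSublinear γ) (h' : IsPositiveSublinear γ') :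
    IsPositiveSublinear (fun x => γ x + γ' x) where
  add_le x y := by linarith [h.add_le x y, h'.add_le x y]
  smul c hc x := by rw [h.smul c hc, h'.smul c hc]; ring
  pos x hx := add_pos (h.pos x hx) (h'.pos x hx)

theorem combo_le (h : IsPositiveSublinear γ) {a b : ℝ} (ha : 0 ≤ a) (hb : 0 ≤ b) (x y : E) :
    γ (a • x + b • y) ≤ a * γ x + b * γ y := by
  rw [← h.smul a ha, ← h.smul b hb]
  exact h.add_le _ _

theorem gauge_sublevel (h : IsPositiveSublinear γ) (x : E) : gauge {y | γ y ≤ 1} x = γ x := by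
  have key : ∀ r : ℝ, 0 < r → (x ∈ r • {y | γ y ≤ 1} ↔ γ x ≤ r) := by
    intro r hr
    rw [Set.mem_smul_set_iff_inv_smul_mem₀ hr.ne', Set.mem_ofPred_eq, h.smul _ (inv_nonneg.2 hr.le),
      inv_mul_le_one₀ hr]
  apply le_antisymm
  · refine le_of_forall_pos_le_add fun ε hε => ?_
    have hr : 0 < γ x + ε := by linarith [h.nonneg x]
    exact gauge_le_of_mem hr.le ((key _ hr).2 (by linarith))
  · have hr : 0 < γ x + 1 := by linarith [h.nonneg x]
    refine le_csInf ⟨γ x + 1, hr, (key _ hr).2 (by linarith)⟩ ?_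
    rintro r ⟨hr, hxr⟩
    exact (key r hr).1 hxr

/-- If `γ` is additive along `p - d • x` and `d • x`, it stays so for smaller `d` and after
averaging `p` with another point on which `γ` is affine. -/
theorem decomposition_combo (h : IsPositiveSublinear γ) {p q x : E} {d s e : ℝ}
    (hs₀ : 0 ≤ s) (hs : s ≤ 1) (he : e ≤ s * d)
    (hp : γ (p - d • x) + d * γ x ≤ γ p)
    (haff : γ (s • p + (1 - s) • q) = s * γ p + (1 - s) * γ q) :
    γ ((s • p + (1 - s) • q) - e • x) + e * γ x ≤ γ (s • p + (1 - s) • q) := by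
  have h1 : (s • p + (1 - s) • q) - e • x
      = (s • (p - d • x) + (1 - s) • q) + (s * d - e) • x := by module
  have h2 := h.add_le (s • (p - d • x) + (1 - s) • q) ((s * d - e) • x)
  have h3 := h.combo_le hs₀ (sub_nonneg.2 hs) (p - d • x) q
  rw [h.smul _ (sub_nonneg.2 he)] at h2
  rw [h1, haff]
  nlinarith [mul_le_mul_of_nonneg_left hp hs₀]

end Module

section Inner

variable {E : Type*} [NormedAddCommGroup E] [InnerProductSpace ℝ E] {γ : E → ℝ}

theorem exists_inner_eq [FiniteDimensional ℝ E] (h : IsPositiveSublinear γ) (y : E) :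
    ∃ v : E, (∀ x, ⟪v, x⟫ ≤ γ x) ∧ ⟪v, y⟫ = γ y := by
  have hker : ∀ c : ℝ, c • y = 0 → c • γ y = 0 := by
    intro c hc
    rcases smul_eq_zero.1 hc with rfl | rfl
    · simp
    · simp [h.zero]
  obtain ⟨g, hg, hle⟩ := exists_extension_of_le_sublinear
    (LinearPMap.mkSpanSingleton' y (γ y) hker) γ
    (fun c hc x => h.smul c hc.le x) h.add_le (by
      rintro ⟨x, hx⟩
      obtain ⟨c, rfl⟩ := Submodule.mem_span_singleton.1 hx
      rw [LinearPMap.mkSpanSingleton'_apply]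
      change c * γ y ≤ γ (c • y)
      rcases le_total 0 c with hc | hc
      · rw [h.smul c hc]
      · exact (mul_nonpos_of_nonpos_of_nonneg hc (h.nonneg y)).trans (h.nonneg _))
  refine ⟨(InnerProductSpace.toDual ℝ E).symm g.toContinuousLinearMap, fun x => ?_, ?_⟩
  · simpa using hle x
  · have := hg ⟨y, Submodule.mem_span_singleton_self y⟩
    simpa using this.trans (LinearPMap.mkSpanSingleton'_apply_self y (γ y) hker _)

theorem inner_le_of_mem_polarSet (h : IsPositiveSublinear γ) {v : E}
    (hv : v ∈ PolarSet {x | γ x ≤ 1}) (x : E) : ⟪v, x⟫ ≤ γ x := by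
  by_cases hx : x = 0
  · simp [hx, h.zero]
  have hpos := h.pos x hx
  have := hv ((γ x)⁻¹ • x) (by
    rw [Set.mem_ofPred_eq, h.smul _ (inv_nonneg.2 hpos.le), inv_mul_cancel₀ hpos.ne'])
  rwa [real_inner_smul_left, inv_mul_le_one₀ hpos, real_inner_comm] at this

theorem mem_polarSet_iff (h : IsPositiveSublinear γ) {v : E} :
    v ∈ PolarSet {x | γ x ≤ 1} ↔ ∀ x, ⟪v, x⟫ ≤ γ x := by
  refine ⟨h.inner_le_of_mem_polarSet, fun hv x hx => ?_⟩
  rw [real_inner_comm]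
  exact (hv x).trans hx

theorem polarSet_add_polarSet [FiniteDimensional ℝ E] {γ₁ γ₂ : E → ℝ}
    (h₁ : IsPositiveSublinear γ₁) (h₂ : IsPositiveSublinear γ₂) :
    PolarSet (PolarSet {x | γ₁ x ≤ 1} + PolarSet {x | γ₂ x ≤ 1})
      = {x | γ₁ x + γ₂ x ≤ 1} := by
  ext y
  constructor
  · intro hy
    obtain ⟨v₁, hv₁, e₁⟩ := h₁.exists_inner_eq y
    obtain ⟨v₂, hv₂, e₂⟩ := h₂.exists_inner_eq y
    have := hy _ (Set.add_mem_add (h₁.mem_polarSet_iff.2 hv₁) (h₂.mem_polarSet_iff.2 hv₂))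
    rwa [inner_add_left, e₁, e₂] at this
  · rintro hy _ ⟨v₁, hv₁, v₂, hv₂, rfl⟩
    change ⟪v₁ + v₂, y⟫ ≤ 1
    rw [inner_add_left]
    exact (add_le_add (h₁.mem_polarSet_iff.1 hv₁ y) (h₂.mem_polarSet_iff.1 hv₂ y)).trans hy

/-- On a convex set `F` avoiding the origin on which `γ` is affine, the linear functional exposing
the face of `{γ ≤ 1}` generated by the rays through `F` supports `γ` exactly along that face. -/
theorem exists_supporting (h : IsPositiveSublinear γ) (hexp : FaciallyExposed {x | γ x ≤ 1})
    {F : Set E} (hF : Convex ℝ F) (hne : F.Nonempty) (h0 : (0 : E) ∉ F)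
    (haff : ∀ x ∈ F, ∀ y ∈ F, ∀ s : ℝ, 0 ≤ s → s ≤ 1 →
      γ (s • x + (1 - s) • y) = s * γ x + (1 - s) * γ y) :
    ∃ w : E, (∀ x, ⟪w, x⟫ ≤ γ x) ∧ (∀ x ∈ F, ⟪w, x⟫ = γ x) ∧
      ∀ x, x ≠ 0 → ⟪w, x⟫ = γ x →
        ∃ p ∈ F, ∃ d : ℝ, 0 < d ∧ γ (p - d • x) + d * γ x ≤ γ p := by
  set G : Set E := {z | γ z ≤ 1 ∧ ∃ p ∈ F, ∃ d : ℝ, 0 < d ∧ γ (p - d • z) + d ≤ γ p}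
  have hFG : ∀ x ∈ F, (γ x)⁻¹ • x ∈ G := by
    intro x hx
    have hpos := h.pos x (fun e => h0 (e ▸ hx))
    refine ⟨?_, x, hx, γ x, hpos, ?_⟩
    · rw [h.smul _ (inv_nonneg.2 hpos.le), inv_mul_cancel₀ hpos.ne']
    · rw [smul_inv_smul₀ hpos.ne', sub_self, h.zero, zero_add]
  have hface : IsFace {x | γ x ≤ 1} G := by
    refine ⟨fun z hz => hz.1, ?_, ?_⟩
    · rw [convex_iff_forall_pos]
      rintro z ⟨hz, p, hp, d, hd, hpd⟩ z' ⟨hz', p', hp', d', hd', hpd'⟩ a b ha hb hab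
      have hD : 0 < a * d' + b * d := by positivity
      have hs₀ : 0 ≤ a * d' / (a * d' + b * d) := by positivity
      have hs₁ : a * d' / (a * d' + b * d) ≤ 1 := (div_le_one hD).2 (by nlinarith)
      have hsd : a * d' / (a * d' + b * d) * d = d * d' / (a * d' + b * d) * a := by ring
      have hsd' : (1 - a * d' / (a * d' + b * d)) * d' = d * d' / (a * d' + b * d) * b := by
        field_simp; ring
      have hc : 0 < d * d' / (a * d' + b * d) := by positivity
      generalize a * d' / (a * d' + b * d) = s at *
      generalize d * d' / (a * d' + b * d) = c at *
      refine ⟨?_, s • p + (1 - s) • p', hF hp hp' hs₀ (sub_nonneg.2 hs₁) (by ring), c, hc, ?_⟩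
      · have := h.combo_le ha.le hb.le z z'
        nlinarith
      · have e : s • p + (1 - s) • p' - c • (a • z + b • z')
            = s • (p - d • z) + (1 - s) • (p' - d' • z') := by
          rw [smul_add, smul_smul, smul_smul, ← hsd, ← hsd']; module
        rw [e, haff p hp p' hp' s hs₀ hs₁]
        have h1 := h.combo_le hs₀ (sub_nonneg.2 hs₁) (p - d • z) (p' - d' • z')
        have h2 := mul_le_mul_of_nonneg_left hpd hs₀
        have h3 := mul_le_mul_of_nonneg_left hpd' (sub_nonneg.2 hs₁)
        have h4 : c = s * d + (1 - s) * d' := by rw [hsd, hsd', ← mul_add, hab, mul_one]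
        nlinarith
    · have aux : ∀ x, γ x ≤ 1 → ∀ y, γ y ≤ 1 → ∀ s t : ℝ, 0 < s → 0 < t → s + t = 1 →
          s • x + t • y ∈ G → x ∈ G := by
        rintro x hx y hy s t hs ht hst ⟨-, p, hp, d, hd, hpd⟩
        refine ⟨hx, p, hp, d * s, by positivity, ?_⟩
        have e : p - (d * s) • x = (p - d • (s • x + t • y)) + (d * t) • y := by module
        have h1 := h.add_le (p - d • (s • x + t • y)) ((d * t) • y)
        have hdt : 0 < d * t := by positivity
        rw [h.smul _ hdt.le] at h1
        have h2 := mul_le_mul_of_nonneg_left hy hdt.le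
        have h3 : d * s + d * t = d := by rw [← mul_add, hst, mul_one]
        rw [e]
        linarith
      intro x hx y hy t ht ht1 hxy
      exact ⟨aux x hx y hy (1 - t) t (by linarith) ht (by ring) hxy,
        aux y hy x hx t (1 - t) ht (by linarith) (by ring) (by rwa [add_comm])⟩
  obtain ⟨q, hq⟩ := hne
  obtain ⟨v, hv⟩ := hexp G hface ⟨_, hFG q hq⟩
  have h0G : (0 : E) ∉ G := by
    rintro ⟨-, p, -, d, hd, hpd⟩
    rw [smul_zero, sub_zero] at hpd
    linarith
  obtain ⟨z, hz⟩ : G.Nonempty := ⟨_, hFG q hq⟩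
  have hzmax : ∀ y, γ y ≤ 1 → ⟪v, y⟫ ≤ ⟪v, z⟫ := by
    rw [hv] at hz
    exact hz.2
  have hmemG : ∀ x, x ∈ G ↔ γ x ≤ 1 ∧ ⟪v, z⟫ ≤ ⟪v, x⟫ := by
    intro x
    constructor
    · intro hx
      rw [hv] at hx
      exact ⟨hx.1, hx.2 z hz.1⟩
    · rintro ⟨hx, hle⟩
      rw [hv]
      exact ⟨hx, fun y hy => (hzmax y hy).trans hle⟩
  have hM : 0 < ⟪v, z⟫ := by
    by_contra hcon
    exact h0G ((hmemG 0).2 ⟨by simp [h.zero], by simpa using hcon⟩)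
  have hle : ∀ x, ⟪(⟪v, z⟫)⁻¹ • v, x⟫ ≤ γ x := by
    refine h.inner_le_of_mem_polarSet fun x hx => ?_
    rw [real_inner_comm, real_inner_smul_left, inv_mul_le_one₀ hM]
    exact hzmax x hx
  have heq : ∀ x, x ≠ 0 → (⟪(⟪v, z⟫)⁻¹ • v, x⟫ = γ x ↔ (γ x)⁻¹ • x ∈ G) := by
    intro x hx
    have hpos := h.pos x hx
    rw [hmemG, h.smul _ (inv_nonneg.2 hpos.le), inv_mul_cancel₀ hpos.ne', real_inner_smul_right,
      ← (hle x).ge_iff_eq, real_inner_smul_left, le_inv_mul_iff₀ hM, le_inv_mul_iff₀ hpos, mul_comm]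
    simp
  refine ⟨(⟪v, z⟫)⁻¹ • v, hle, fun x hx => (heq x fun e => h0 (e ▸ hx)).2 (hFG x hx), ?_⟩
  intro x hx hwx
  obtain ⟨-, p, hp, d, hd, hpd⟩ := (heq x hx).1 hwx
  have hpos := h.pos x hx
  refine ⟨p, hp, d * (γ x)⁻¹, by positivity, ?_⟩
  rwa [inv_mul_cancel_right₀ hpos.ne', ← smul_smul]

/-- A face of `{γ ≤ 1}` that meets `{γ < 1}` is the whole set. -/
theorem face_eq_of_lt (h : IsPositiveSublinear γ) {F : Set E} (hF : IsFace {x | γ x ≤ 1} F)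
    {p : E} (hp : p ∈ F) (hlt : γ p < 1) : F = {x | γ x ≤ 1} := by
  refine hF.1.antisymm fun y hy => ?_
  have hn := h.nonneg (p - y)
  obtain ⟨e, he, hle⟩ : ∃ e : ℝ, 0 < e ∧ e * γ (p - y) ≤ 1 - γ p := by
    refine ⟨(1 - γ p) / (γ (p - y) + 1), div_pos (by linarith) (by linarith), ?_⟩
    rw [div_mul_eq_mul_div, div_le_iff₀ (by linarith)]
    nlinarith
  have hmem : γ (p + e • (p - y)) ≤ 1 := by
    have := h.add_le p (e • (p - y))
    rw [h.smul e he.le] at this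
    linarith
  have he1 : 1 + e ≠ 0 := by positivity
  refine (hF.2.2 hmem hy (t := e / (1 + e)) (by positivity)
    ((div_lt_one (by positivity)).2 (by linarith)) ?_).2
  have : (1 - e / (1 + e)) • (p + e • (p - y)) + (e / (1 + e)) • y = p := by
    match_scalars <;> field_simp <;> ring
  rwa [this]

theorem faciallyExposed_add {γ₁ γ₂ : E → ℝ}
    (h₁ : IsPositiveSublinear γ₁) (h₂ : IsPositiveSublinear γ₂)
    (hexp₁ : FaciallyExposed {x | γ₁ x ≤ 1}) (hexp₂ : FaciallyExposed {x | γ₂ x ≤ 1}) :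
    FaciallyExposed {x | γ₁ x + γ₂ x ≤ 1} := by
  intro F hF hne
  by_cases hlt : ∃ p ∈ F, γ₁ p + γ₂ p < 1
  · obtain ⟨p, hp, hplt⟩ := hlt
    refine ⟨0, ((h₁.add h₂).face_eq_of_lt hF hp hplt).trans ?_⟩
    ext x
    simp
  push Not at hlt
  have hone : ∀ x ∈ F, γ₁ x + γ₂ x = 1 := fun x hx => le_antisymm (hF.1 hx) (hlt x hx)
  have h0 : (0 : E) ∉ F := fun h0 => by
    have := hone 0 h0
    rw [h₁.zero, h₂.zero] at this
    norm_num at this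
  have haff : ∀ x ∈ F, ∀ y ∈ F, ∀ s : ℝ, 0 ≤ s → s ≤ 1 →
      γ₁ (s • x + (1 - s) • y) = s * γ₁ x + (1 - s) * γ₁ y ∧
      γ₂ (s • x + (1 - s) • y) = s * γ₂ x + (1 - s) * γ₂ y := by
    intro x hx y hy s hs₀ hs₁
    have e := hone _ (hF.2.1 hx hy hs₀ (sub_nonneg.2 hs₁) (by ring))
    have i₁ := h₁.combo_le hs₀ (sub_nonneg.2 hs₁) x y
    have i₂ := h₂.combo_le hs₀ (sub_nonneg.2 hs₁) x y
    have ex : s * γ₁ x + s * γ₂ x = s := by rw [← mul_add, hone x hx, mul_one]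
    have ey : (1 - s) * γ₁ y + (1 - s) * γ₂ y = 1 - s := by rw [← mul_add, hone y hy, mul_one]
    constructor <;> linarith
  obtain ⟨w₁, hle₁, heq₁, hw₁⟩ := h₁.exists_supporting hexp₁ hF.2.1 hne h0
    fun x hx y hy s hs₀ hs₁ => (haff x hx y hy s hs₀ hs₁).1
  obtain ⟨w₂, hle₂, heq₂, hw₂⟩ := h₂.exists_supporting hexp₂ hF.2.1 hne h0
    fun x hx y hy s hs₀ hs₁ => (haff x hx y hy s hs₀ hs₁).2
  refine ⟨w₁ + w₂, Set.Subset.antisymm (fun x hx => ⟨hF.1 hx, fun y hy => ?_⟩) ?_⟩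
  · rw [inner_add_left, inner_add_left, heq₁ x hx, heq₂ x hx, hone x hx]
    exact (add_le_add (hle₁ y) (hle₂ y)).trans hy
  rintro x ⟨hxQ, hxmax⟩
  obtain ⟨q, hq⟩ := hne
  have hx1 := hxmax q (hF.1 hq)
  rw [inner_add_left, inner_add_left, heq₁ q hq, heq₂ q hq, hone q hq] at hx1
  have hxQ' : γ₁ x + γ₂ x ≤ 1 := hxQ
  have i₁ := hle₁ x
  have i₂ := hle₂ x
  have hx0 : x ≠ 0 := by
    rintro rfl
    simp only [inner_zero_right] at hx1
    norm_num at hx1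
  obtain ⟨p₁, hp₁, d₁, hd₁, hpd₁⟩ := hw₁ x hx0 (by linarith)
  obtain ⟨p₂, hp₂, d₂, hd₂, hpd₂⟩ := hw₂ x hx0 (by linarith)
  have hhalf : (1 : ℝ) - 1 / 2 = 1 / 2 := by norm_num
  have hpF : (1 / 2 : ℝ) • p₁ + (1 - 1 / 2 : ℝ) • p₂ ∈ F :=
    hF.2.1 hp₁ hp₂ (by norm_num) (by norm_num) (by norm_num)
  have hswap : (1 / 2 : ℝ) • p₂ + (1 - 1 / 2 : ℝ) • p₁
      = (1 / 2 : ℝ) • p₁ + (1 - 1 / 2 : ℝ) • p₂ := by rw [hhalf, add_comm]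
  obtain ⟨e, he, he₁, he₂, he1⟩ : ∃ e : ℝ, 0 < e ∧ e ≤ 1 / 2 * d₁ ∧ e ≤ 1 / 2 * d₂ ∧ e < 1 :=
    ⟨min (min (1 / 2 * d₁) (1 / 2 * d₂)) (1 / 2), by positivity,
      (min_le_left _ _).trans (min_le_left _ _), (min_le_left _ _).trans (min_le_right _ _),
      (min_le_right _ _).trans_lt (by norm_num)⟩
  have c₁ := h₁.decomposition_combo (q := p₂) (s := 1 / 2) (by norm_num) (by norm_num) he₁
    hpd₁ (haff p₁ hp₁ p₂ hp₂ _ (by norm_num) (by norm_num)).1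
  have c₂ := h₂.decomposition_combo (q := p₁) (s := 1 / 2) (by norm_num) (by norm_num) he₂
    hpd₂ (haff p₂ hp₂ p₁ hp₁ _ (by norm_num) (by norm_num)).2
  rw [hswap] at c₂
  generalize (1 / 2 : ℝ) • p₁ + (1 - 1 / 2 : ℝ) • p₂ = p at *
  have hp1 := hone p hpF
  have hxg : γ₁ x + γ₂ x = 1 := by linarith
  have h1e : 0 < 1 - e := by linarith
  have hexg : e * γ₁ x + e * γ₂ x = e := by rw [← mul_add, hxg, mul_one]
  have hy : γ₁ ((1 - e)⁻¹ • (p - e • x)) + γ₂ ((1 - e)⁻¹ • (p - e • x)) ≤ 1 := by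
    rw [h₁.smul _ (inv_nonneg.2 h1e.le), h₂.smul _ (inv_nonneg.2 h1e.le), ← mul_add,
      inv_mul_le_one₀ h1e]
    linarith
  refine (hF.2.2 hy hxQ he he1 ?_).2
  rwa [smul_inv_smul₀ h1e.ne', sub_add_cancel]

end Inner

end IsPositiveSublinear

theorem isPositiveSublinear_gauge {E : Type*} [NormedAddCommGroup E] [NormedSpace ℝ E] {Q : Set E}
    (hcomp : IsCompact Q) (hconv : Convex ℝ Q) (h0 : (0 : E) ∈ interior Q) :
    IsPositiveSublinear (gauge Q) where
  add_le := gauge_add_le hconv (absorbent_nhds_zero (mem_interior_iff_mem_nhds.1 h0))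
  smul c hc x := by rw [gauge_smul_of_nonneg hc, smul_eq_mul]
  pos x hx := (gauge_pos (absorbent_nhds_zero (mem_interior_iff_mem_nhds.1 h0))
    (NormedSpace.isVonNBounded_of_isBounded ℝ hcomp.isBounded)).2 hx

theorem setOf_gauge_le_one_eq {E : Type*} [NormedAddCommGroup E] [NormedSpace ℝ E] {Q : Set E}
    (hcomp : IsCompact Q) (hconv : Convex ℝ Q) (h0 : (0 : E) ∈ interior Q) :
    {x | gauge Q x ≤ 1} = Q := by
  ext x
  rw [Set.mem_ofPred_eq, gauge_le_one_iff_mem_closure hconv (mem_interior_iff_mem_nhds.1 h0),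
    hcomp.isClosed.closure_eq]

/-- **Sum of gauges.**  For compact convex `Q₁, Q₂` with `0` interior, `γ_{Q₁} + γ_{Q₂}` is the
gauge of `(Q₁° + Q₂°)°`; moreover if `Q₁` and `Q₂` are facially exposed then so is
`(Q₁° + Q₂°)°`. -/
theorem stmt12 {E : Type*} [NormedAddCommGroup E] [InnerProductSpace ℝ E]
    [FiniteDimensional ℝ E] (Q₁ Q₂ : Set E)
    (h₁comp : IsCompact Q₁) (h₁conv : Convex ℝ Q₁) (h₁0 : (0 : E) ∈ interior Q₁)
    (h₂comp : IsCompact Q₂) (h₂conv : Convex ℝ Q₂) (h₂0 : (0 : E) ∈ interior Q₂) :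
    (∀ x : E, gauge Q₁ x + gauge Q₂ x = gauge (PolarSet (PolarSet Q₁ + PolarSet Q₂)) x) ∧
    (FaciallyExposed Q₁ → FaciallyExposed Q₂ →
      FaciallyExposed (PolarSet (PolarSet Q₁ + PolarSet Q₂))) := by
  have h₁ := isPositiveSublinear_gauge h₁comp h₁conv h₁0
  have h₂ := isPositiveSublinear_gauge h₂comp h₂conv h₂0
  have e₁ := setOf_gauge_le_one_eq h₁comp h₁conv h₁0
  have e₂ := setOf_gauge_le_one_eq h₂comp h₂conv h₂0
  have hpolar := h₁.polarSet_add_polarSet h₂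
  rw [e₁, e₂] at hpolar
  rw [hpolar]
  refine ⟨fun x => ((h₁.add h₂).gauge_sublevel x).symm, fun hexp₁ hexp₂ => ?_⟩
  exact h₁.faciallyExposed_add h₂ (by rwa [e₁]) (by rwa [e₂])
end
end

section
/- The rank sparsity ball ℬ_{1,*} := {X ∈ M^{n×m} : ‖X‖₁ + ‖X‖_* ≤ 1} is facially exposed: every face of ℬ_{1,*} is an exposed face. -/
noncomputable section

open Set

/-- The entrywise `l₁`-norm of a matrix. -/
def l1Norm {n m : ℕ} (X : Matrix (Fin n) (Fin m) ℝ) : ℝ := ∑ i, ∑ j, |X i j|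

/-- The nuclear norm of a matrix: the sum of its singular values, i.e. of the square roots of
the eigenvalues of `X * Xᵀ`. -/
noncomputable def nuclearNorm {n m : ℕ} (X : Matrix (Fin n) (Fin m) ℝ) : ℝ :=
  ∑ i, Real.sqrt ((Matrix.isHermitian_mul_conjTranspose_self X).eigenvalues i)

/-- The trace inner product `⟨V, X⟩ = tr(Vᵀ X)`. -/
def mInner {n m : ℕ} (V X : Matrix (Fin n) (Fin m) ℝ) : ℝ := ∑ i, ∑ j, V i j * X i j

open Matrix

/-- The matrix with orthonormal eigenvectors given by the columns of `U` and eigenvalues `d`. -/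
def spectralMatrix {n : ℕ} (U : unitaryGroup (Fin n) ℝ) (d : Fin n → ℝ) :
    Matrix (Fin n) (Fin n) ℝ :=
  (U : Matrix (Fin n) (Fin n) ℝ) * diagonal d * (U : Matrix (Fin n) (Fin n) ℝ)ᴴ

section spectralMatrix

variable {n : ℕ} (U : unitaryGroup (Fin n) ℝ) (d e : Fin n → ℝ)

lemma spectralMatrix_mul :
    spectralMatrix U d * spectralMatrix U e = spectralMatrix U (d * e) := by
  have h : (U : Matrix (Fin n) (Fin n) ℝ)ᴴ * U = 1 := Unitary.coe_star_mul_self U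
  have h' : diagonal (d * e) = diagonal d * diagonal e := (diagonal_mul_diagonal d e).symm
  simp only [spectralMatrix, h', Matrix.mul_assoc]
  rw [← Matrix.mul_assoc (U : Matrix (Fin n) (Fin n) ℝ)ᴴ, h, Matrix.one_mul]

lemma spectralMatrix_sub :
    spectralMatrix U d - spectralMatrix U e = spectralMatrix U (d - e) := by
  have h : diagonal (d - e) = diagonal d - diagonal e := (diagonal_sub d e).symm
  rw [spectralMatrix, spectralMatrix, spectralMatrix, h, Matrix.mul_sub, Matrix.sub_mul]

lemma smul_spectralMatrix (c : ℝ) :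
    c • spectralMatrix U d = spectralMatrix U (c • d) := by
  simp [spectralMatrix, diagonal_smul]

lemma spectralMatrix_one : spectralMatrix U 1 = 1 := by
  have h : (U : Matrix (Fin n) (Fin n) ℝ) * (U : Matrix (Fin n) (Fin n) ℝ)ᴴ = 1 :=
    Unitary.coe_mul_star_self U
  have h' : diagonal (1 : Fin n → ℝ) = 1 := diagonal_one
  rw [spectralMatrix, h', Matrix.mul_one, h]

lemma trace_spectralMatrix : (spectralMatrix U d).trace = ∑ i, d i := by
  have h : (U : Matrix (Fin n) (Fin n) ℝ)ᴴ * U = 1 := Unitary.coe_star_mul_self U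
  rw [spectralMatrix, trace_mul_comm, ← Matrix.mul_assoc, h, Matrix.one_mul, trace_diagonal]

variable {d} in
lemma posSemidef_spectralMatrix (hd : ∀ i, 0 ≤ d i) : (spectralMatrix U d).PosSemidef :=
  (PosSemidef.diagonal hd).mul_mul_conjTranspose_same _

lemma conjTranspose_spectralMatrix : (spectralMatrix U d)ᴴ = spectralMatrix U d := by
  simp [spectralMatrix, Matrix.mul_assoc]

end spectralMatrix

lemma Matrix.IsHermitian.eq_spectralMatrix {n : ℕ} {A : Matrix (Fin n) (Fin n) ℝ}
    (hA : A.IsHermitian) : A = spectralMatrix hA.eigenvectorUnitary hA.eigenvalues := by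
  conv_lhs => rw [hA.spectral_theorem]
  rfl

/-- A positive semidefinite matrix is dominated by its trace times the identity. -/
lemma Matrix.PosSemidef.trace_smul_one_sub {n : ℕ} {A : Matrix (Fin n) (Fin n) ℝ}
    (hA : A.PosSemidef) : (A.trace • (1 : Matrix (Fin n) (Fin n) ℝ) - A).PosSemidef := by
  set U := hA.1.eigenvectorUnitary
  set d := hA.1.eigenvalues
  have hA' : A = spectralMatrix U d := hA.1.eq_spectralMatrix
  rw [hA', trace_spectralMatrix, ← spectralMatrix_one U, smul_spectralMatrix,
    spectralMatrix_sub]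
  refine posSemidef_spectralMatrix U fun i => ?_
  have := Finset.single_le_sum (fun j _ => hA.eigenvalues_nonneg j) (Finset.mem_univ i)
  simpa [d] using this

open scoped MatrixOrder in
lemma Matrix.PosSemidef.eq_of_mul_self_eq {n : ℕ} {A B : Matrix (Fin n) (Fin n) ℝ}
    (hA : A.PosSemidef) (hB : B.PosSemidef) (h : A * A = B * B) : A = B := by
  rw [← CFC.sqrt_unique h hA.nonneg, CFC.sqrt_unique rfl hB.nonneg]

lemma mInner_eq_trace {n m : ℕ} (V X : Matrix (Fin n) (Fin m) ℝ) :
    mInner V X = (X * Vᴴ).trace := by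
  simp [mInner, Matrix.trace, Matrix.mul_apply, mul_comm]

lemma mInner_self_eq_zero {n m : ℕ} {V : Matrix (Fin n) (Fin m) ℝ} (h : mInner V V ≤ 0) :
    V = 0 := by
  have h0 : 0 ≤ mInner V V :=
    Finset.sum_nonneg fun i _ => Finset.sum_nonneg fun j _ => mul_self_nonneg _
  have := le_antisymm h h0
  rwa [mInner_eq_trace, trace_mul_conjTranspose_self_eq_zero_iff] at this

section mInner

variable {n m : ℕ} (V W X Y : Matrix (Fin n) (Fin m) ℝ) (c : ℝ)

lemma mInner_add_left : mInner (V + W) X = mInner V X + mInner W X := by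
  simp [mInner, add_mul, Finset.sum_add_distrib]

lemma mInner_add_right : mInner V (X + Y) = mInner V X + mInner V Y := by
  simp [mInner, mul_add, Finset.sum_add_distrib]

lemma mInner_sub_right : mInner V (X - Y) = mInner V X - mInner V Y := by
  simp [mInner, mul_sub, Finset.sum_sub_distrib]

lemma mInner_smul_right : mInner V (c • X) = c * mInner V X := by
  simp [mInner, Finset.mul_sum, mul_left_comm]

end mInner

/-- Polar decomposition `X = P W`, where `W` is a partial isometry and `P` is positive definite on
the final space of `W`. -/
lemma exists_polar_decomposition {n m : ℕ} (X : Matrix (Fin n) (Fin m) ℝ) :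
    ∃ (P : Matrix (Fin n) (Fin n) ℝ) (W : Matrix (Fin n) (Fin m) ℝ) (K : ℝ),
      P.PosSemidef ∧ P.trace = nuclearNorm X ∧ P * P = X * Xᴴ ∧ X = P * W ∧
      W * Wᴴ * (W * Wᴴ) = W * Wᴴ ∧ P * (W * Wᴴ) = P ∧ 0 ≤ K ∧
      (K • P - W * Wᴴ).PosSemidef := by
  have hX := isHermitian_mul_conjTranspose_self X
  have hpos := (posSemidef_self_mul_conjTranspose X).eigenvalues_nonneg
  set U := hX.eigenvectorUnitary
  set s : Fin n → ℝ := fun i => √(hX.eigenvalues i)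
  have hs0 : ∀ i, 0 ≤ s i := fun i => Real.sqrt_nonneg _
  have hsi : ∀ i, 0 ≤ (s i)⁻¹ := fun i => inv_nonneg.2 (hs0 i)
  have hXX : X * Xᴴ = spectralMatrix U (s * s) := by
    rw [hX.eq_spectralMatrix]
    congr 1
    ext i
    exact (Real.mul_self_sqrt (hpos i)).symm
  have hinv : s⁻¹ * (s * s) * s⁻¹ = s * s⁻¹ := by
    ext i
    by_cases h : s i = 0 <;> simp [h]
  have hE : spectralMatrix U s⁻¹ * X * (spectralMatrix U s⁻¹ * X)ᴴ =
      spectralMatrix U (s * s⁻¹) := by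
    rw [conjTranspose_mul, conjTranspose_spectralMatrix, Matrix.mul_assoc, ← Matrix.mul_assoc X,
      hXX, ← Matrix.mul_assoc, spectralMatrix_mul, spectralMatrix_mul, hinv]
  refine ⟨spectralMatrix U s, spectralMatrix U s⁻¹ * X, ∑ i, (s i)⁻¹,
    posSemidef_spectralMatrix U hs0, trace_spectralMatrix U s, ?_, ?_, ?_, ?_,
    Finset.sum_nonneg fun i _ => hsi i, ?_⟩
  · rw [spectralMatrix_mul, hXX]
  · rw [← Matrix.mul_assoc, spectralMatrix_mul, ← sub_eq_zero,
      ← self_mul_conjTranspose_eq_zero]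
    have : X - spectralMatrix U (s * s⁻¹) * X = spectralMatrix U (1 - s * s⁻¹) * X := by
      rw [← spectralMatrix_sub, spectralMatrix_one, Matrix.sub_mul, Matrix.one_mul]
    rw [this, conjTranspose_mul, conjTranspose_spectralMatrix, Matrix.mul_assoc,
      ← Matrix.mul_assoc X, hXX, ← Matrix.mul_assoc, spectralMatrix_mul, spectralMatrix_mul]
    have : (1 - s * s⁻¹) * (s * s) * (1 - s * s⁻¹) = 0 := by
      ext i
      by_cases h : s i = 0 <;> simp [h]
    rw [this]
    have h0 : diagonal (0 : Fin n → ℝ) = 0 := diagonal_zero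
    simp [spectralMatrix, h0]
  · rw [hE, spectralMatrix_mul]
    congr 1
    ext i
    by_cases h : s i = 0 <;> simp [h]
  · rw [hE, spectralMatrix_mul]
    congr 1
    ext i
    by_cases h : s i = 0 <;> simp [h]
  · rw [hE, smul_spectralMatrix, spectralMatrix_sub]
    refine posSemidef_spectralMatrix U fun i => ?_
    have := Finset.single_le_sum (fun j _ => hsi j) (Finset.mem_univ i)
    have := mul_le_mul_of_nonneg_right this (hs0 i)
    simp only [Pi.sub_apply, Pi.smul_apply, Pi.mul_apply, Pi.inv_apply, smul_eq_mul]
    linarith [mul_comm (s i) (s i)⁻¹]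

lemma nuclearNorm_eq_trace {n m : ℕ} {X : Matrix (Fin n) (Fin m) ℝ}
    {S : Matrix (Fin n) (Fin n) ℝ} (hS : S.PosSemidef) (h : S * S = X * Xᴴ) :
    nuclearNorm X = S.trace := by
  obtain ⟨P, W, K, hP, htr, hPP, -⟩ := exists_polar_decomposition X
  rw [← htr, hP.eq_of_mul_self_eq hS (hPP.trans h.symm)]

lemma nuclearNorm_smul {n m : ℕ} (c : ℝ) (X : Matrix (Fin n) (Fin m) ℝ) :
    nuclearNorm (c • X) = |c| * nuclearNorm X := by
  obtain ⟨P, W, K, hP, htr, hPP, -⟩ := exists_polar_decomposition X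
  rw [nuclearNorm_eq_trace (hP.smul (abs_nonneg c)), trace_smul, htr, smul_eq_mul]
  simp [hPP, smul_smul]

lemma nuclearNorm_nonneg {n m : ℕ} (X : Matrix (Fin n) (Fin m) ℝ) : 0 ≤ nuclearNorm X :=
  Finset.sum_nonneg fun _ _ => Real.sqrt_nonneg _

lemma l1Norm_nonneg {n m : ℕ} (X : Matrix (Fin n) (Fin m) ℝ) : 0 ≤ l1Norm X :=
  Finset.sum_nonneg fun _ _ => Finset.sum_nonneg fun _ _ => abs_nonneg _

lemma l1Norm_smul {n m : ℕ} (c : ℝ) (X : Matrix (Fin n) (Fin m) ℝ) :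
    l1Norm (c • X) = |c| * l1Norm X := by
  simp [l1Norm, abs_mul, Finset.mul_sum]

lemma eq_zero_of_l1Norm_eq_zero {n m : ℕ} {X : Matrix (Fin n) (Fin m) ℝ}
    (h : l1Norm X = 0) : X = 0 := by
  ext i j
  have hi := (Finset.sum_eq_zero_iff_of_nonneg
    fun i _ => Finset.sum_nonneg fun j _ => abs_nonneg (X i j)).1 h i (Finset.mem_univ i)
  have hj := (Finset.sum_eq_zero_iff_of_nonneg
    fun j _ => abs_nonneg (X i j)).1 hi j (Finset.mem_univ j)
  simpa using hj

open scoped MatrixOrder in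
/-- Duality between the nuclear norm and the spectral norm, with the equality case. -/
lemma mInner_le_nuclearNorm {n m : ℕ} {W : Matrix (Fin n) (Fin m) ℝ}
    (hW : (1 - W * Wᴴ).PosSemidef) (Y : Matrix (Fin n) (Fin m) ℝ) :
    mInner W Y ≤ nuclearNorm Y ∧
      (mInner W Y = nuclearNorm Y → ∃ P : Matrix (Fin n) (Fin n) ℝ,
        P.PosSemidef ∧ P * P = Y * Yᴴ ∧ Y = P * W) := by
  obtain ⟨P, T, K, hP, htr, hPP, hY, -, hPT, -⟩ := exists_polar_decomposition Y
  obtain ⟨R, hR⟩ : ∃ R : Matrix (Fin n) (Fin n) ℝ, P = Rᴴ * R :=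
    CStarAlgebra.nonneg_iff_eq_star_mul_self.1 hP.nonneg
  have hWtr : (P * (W * Wᴴ)).trace ≤ P.trace := by
    have := (hW.mul_mul_conjTranspose_same R).trace_nonneg
    rw [trace_mul_comm, ← Matrix.mul_assoc, ← hR, Matrix.mul_sub, Matrix.mul_one,
      trace_sub] at this
    linarith
  have hexp : mInner (R * W - R * T) (R * W - R * T) =
      (P * (W * Wᴴ)).trace + P.trace - 2 * mInner W Y := by
    have key : ∀ A B : Matrix (Fin n) (Fin m) ℝ,
        mInner (R * A) (R * B) = (P * (B * Aᴴ)).trace := by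
      intro A B
      rw [mInner_eq_trace, conjTranspose_mul, ← Matrix.mul_assoc, trace_mul_comm, hR]
      simp only [Matrix.mul_assoc]
    have comm : ∀ A B : Matrix (Fin n) (Fin m) ℝ, mInner A B = mInner B A := by
      intro A B
      simp [mInner, mul_comm]
    rw [mInner_sub_right, comm _ (R * W), comm _ (R * T), mInner_sub_right, mInner_sub_right,
      comm (R * T) (R * W), key, key, key, hPT, mInner_eq_trace W Y]
    conv_rhs => rw [hY]
    rw [Matrix.mul_assoc]
    ring
  have h0 : 0 ≤ mInner (R * W - R * T) (R * W - R * T) :=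
    Finset.sum_nonneg fun i _ => Finset.sum_nonneg fun j _ => mul_self_nonneg _
  refine ⟨by linarith, fun h => ⟨P, hP, hPP, ?_⟩⟩
  have := mInner_self_eq_zero (V := R * W - R * T) (by linarith)
  rw [hY, hR, Matrix.mul_assoc, Matrix.mul_assoc, sub_eq_zero.1 this]

lemma exists_subgradient_nuclearNorm {n m : ℕ} (X : Matrix (Fin n) (Fin m) ℝ) :
    ∃ W : Matrix (Fin n) (Fin m) ℝ, (∀ Y, mInner W Y ≤ nuclearNorm Y) ∧
      mInner W X = nuclearNorm X ∧
      ∀ Y, mInner W Y = nuclearNorm Y → ∃ ε : ℝ, 0 < ε ∧ ∀ δ, 0 < δ → δ ≤ ε →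
        nuclearNorm (X + δ • (X - Y)) = mInner W (X + δ • (X - Y)) := by
  obtain ⟨P, W, K, hP, htr, hPP, hX, hEE, hPE, hK, hKP⟩ := exists_polar_decomposition X
  set E := W * Wᴴ with hE
  have hEs : Eᴴ = E := by simp [hE]
  have hG : (1 - E)ᴴ * (1 - E) = 1 - E := by
    rw [conjTranspose_sub, conjTranspose_one, hEs, Matrix.mul_sub, Matrix.sub_mul _ _ E,
      hEE, Matrix.mul_one, Matrix.one_mul, sub_self, sub_zero]
  have hW : (1 - E).PosSemidef := hG ▸ posSemidef_conjTranspose_mul_self (1 - E)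
  have inner_mul : ∀ S : Matrix (Fin n) (Fin n) ℝ, S * E = S → mInner W (S * W) = S.trace := by
    intro S hS
    rw [mInner_eq_trace, Matrix.mul_assoc, ← hE, hS]
  refine ⟨W, fun Y => (mInner_le_nuclearNorm hW Y).1, ?_, fun Y hY => ?_⟩
  · conv_lhs => rw [hX]
    rw [inner_mul P hPE, htr]
  obtain ⟨Q, hQ, hQQ, hYQ⟩ := (mInner_le_nuclearNorm hW Y).2 hY
  have hQs : Qᴴ = Q := hQ.1
  have hEQ : E * Q = Q := by
    have h1 : Q * E * Q = Q * Q := by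
      rw [hQQ, hYQ, conjTranspose_mul, hQs]
      simp only [hE, Matrix.mul_assoc]
    have h2 : ((1 - E) * Q)ᴴ * ((1 - E) * Q) = 0 := by
      rw [conjTranspose_mul, Matrix.mul_assoc, ← Matrix.mul_assoc (1 - E)ᴴ, hG, hQs,
        Matrix.sub_mul, Matrix.mul_sub, Matrix.one_mul, ← Matrix.mul_assoc, h1, sub_self]
    have h3 := conjTranspose_mul_self_eq_zero.1 h2
    rw [Matrix.sub_mul, Matrix.one_mul, sub_eq_zero] at h3
    exact h3.symm
  have hQE : Q * E = Q := by
    have := congrArg conjTranspose hEQ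
    rwa [conjTranspose_mul, hQs, hEs] at this
  have hC := hQ.trace_nonneg
  set C := Q.trace
  have hCE : (C • E - Q).PosSemidef := by
    have := hQ.trace_smul_one_sub.mul_mul_conjTranspose_same E
    rwa [hEs, Matrix.mul_sub, Matrix.sub_mul, hEQ, hQE, Matrix.mul_smul, Matrix.mul_one,
      Matrix.smul_mul, hEE] at this
  have hCK : 0 < C * K + 1 := by positivity
  refine ⟨(C * K + 1)⁻¹, by positivity, fun δ hδ hδε => ?_⟩
  have hδ1 : δ * (C * K) ≤ 1 := by
    have := mul_le_mul_of_nonneg_right hδε hCK.le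
    rw [inv_mul_cancel₀ hCK.ne'] at this
    linarith
  set S := P + δ • (P - Q) with hS
  have hSpos : S.PosSemidef := by
    have : S = (1 + δ - δ * (C * K)) • P + (δ * C) • (K • P - E) + δ • (C • E - Q) := by
      rw [hS]
      module
    rw [this]
    exact ((hP.smul (by linarith)).add (hKP.smul (by positivity))).add (hCE.smul hδ.le)
  have hSE : S * E = S := by
    rw [hS, Matrix.add_mul, Matrix.smul_mul, Matrix.sub_mul, hPE, hQE]
  have hZ : X + δ • (X - Y) = S * W := by
    rw [hS, Matrix.add_mul, Matrix.smul_mul, Matrix.sub_mul, ← hX, ← hYQ]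
  rw [hZ, inner_mul S hSE]
  refine nuclearNorm_eq_trace hSpos ?_
  rw [conjTranspose_mul, Matrix.mul_assoc, ← Matrix.mul_assoc W, ← hE, ← Matrix.mul_assoc, hSE,
    hSpos.1]

lemma exists_subgradient_l1Norm {n m : ℕ} (X : Matrix (Fin n) (Fin m) ℝ) :
    ∃ W : Matrix (Fin n) (Fin m) ℝ, (∀ Y, mInner W Y ≤ l1Norm Y) ∧
      mInner W X = l1Norm X ∧
      ∀ Y, mInner W Y = l1Norm Y → ∃ ε : ℝ, 0 < ε ∧ ∀ δ, 0 < δ → δ ≤ ε →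
        l1Norm (X + δ • (X - Y)) = mInner W (X + δ • (X - Y)) := by
  have hle : ∀ x y : ℝ, SignType.sign x * y ≤ |y| := by
    intro x y
    rcases lt_trichotomy x 0 with h | h | h
    · simpa [h] using neg_le_abs y
    · simp [h]
    · simpa [h] using le_abs_self y
  refine ⟨of fun i j => (SignType.sign (X i j) : ℝ), fun Y => ?_, ?_, fun Y hY => ?_⟩
  · exact Finset.sum_le_sum fun i _ => Finset.sum_le_sum fun j _ => hle _ _
  · simp [mInner, l1Norm, sign_mul_self]
  have hY' : ∀ i j, SignType.sign (X i j) * Y i j = |Y i j| := by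
    intro i j
    have hi := (Finset.sum_eq_sum_iff_of_le
      fun i _ => Finset.sum_le_sum fun j _ => hle (X i j) (Y i j)).1 hY i (Finset.mem_univ i)
    exact (Finset.sum_eq_sum_iff_of_le fun j _ => hle (X i j) (Y i j)).1 hi j (Finset.mem_univ j)
  set K := ∑ i, ∑ j, |Y i j| / |X i j|
  have hterm : ∀ i j, 0 ≤ |Y i j| / |X i j| := fun i j => by positivity
  have hK : ∀ i j, |Y i j| / |X i j| ≤ K := fun i j =>
    (Finset.single_le_sum (fun j _ => hterm i j) (Finset.mem_univ j)).trans
      (Finset.single_le_sum (f := fun i => ∑ j, |Y i j| / |X i j|)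
        (fun i _ => Finset.sum_nonneg fun j _ => hterm i j) (Finset.mem_univ i))
  have hK0 : 0 ≤ K := Finset.sum_nonneg fun i _ => Finset.sum_nonneg fun j _ => hterm i j
  have hK1 : 0 < K + 1 := by positivity
  refine ⟨(K + 1)⁻¹, by positivity, fun δ hδ hδε => ?_⟩
  refine Finset.sum_congr rfl fun i _ => Finset.sum_congr rfl fun j _ => ?_
  simp only [of_apply, Matrix.add_apply, Matrix.smul_apply, Matrix.sub_apply, smul_eq_mul]
  have hy := hY' i j
  have hδ1 : δ * K ≤ 1 := by
    have := mul_le_mul_of_nonneg_right hδε hK1.le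
    rw [inv_mul_cancel₀ hK1.ne'] at this
    linarith
  by_cases hx : X i j = 0
  · simp only [hx, sign_zero, SignType.coe_zero, zero_mul] at hy
    simp [hx, abs_eq_zero.1 hy.symm]
  have hxy : δ * |Y i j| ≤ |X i j| := by
    have h1 : |Y i j| ≤ K * |X i j| := (div_le_iff₀ (abs_pos.2 hx)).1 (hK i j)
    have h2 := mul_le_mul_of_nonneg_left h1 hδ.le
    have h3 := mul_le_mul_of_nonneg_right hδ1 (abs_nonneg (X i j))
    linarith
  have hx0 := mul_nonneg hδ.le (abs_nonneg (X i j))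
  rcases lt_or_gt_of_ne hx with h | h
  · simp only [h, sign_neg, SignType.coe_neg_one, neg_mul, one_mul] at hy ⊢
    rw [← hy, abs_of_neg h] at hxy
    rw [abs_of_neg h] at hx0
    exact abs_of_nonpos (by linarith)
  · simp only [h, sign_pos, SignType.coe_one, one_mul] at hy ⊢
    rw [← hy, abs_of_pos h] at hxy
    rw [abs_of_pos h] at hx0
    exact abs_of_nonneg (by linarith)

attribute [local instance] Matrix.normedAddCommGroup Matrix.normedSpace

/-- A nonempty convex set of matrices has a point from which every segment in the set can be
prolonged. -/
lemma exists_prolongation_point {n m : ℕ} {F : Set (Matrix (Fin n) (Fin m) ℝ)}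
    (hF : Convex ℝ F) (hne : F.Nonempty) :
    ∃ X ∈ F, ∀ Y ∈ F, ∃ δ : ℝ, 0 < δ ∧ X + δ • (X - Y) ∈ F := by
  obtain ⟨X, hX⟩ := hne.intrinsicInterior hF
  refine ⟨X, intrinsicInterior_subset hX, fun Y hY => ?_⟩
  obtain ⟨x, hx, rfl⟩ := mem_intrinsicInterior.1 hX
  have hmem : ∀ t : ℝ, (x : Matrix (Fin n) (Fin m) ℝ) +
      t • ((x : Matrix (Fin n) (Fin m) ℝ) - Y) ∈ affineSpan ℝ F := by
    intro t
    have := AffineSubspace.smul_vsub_vadd_mem (affineSpan ℝ F) t x.2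
      (subset_affineSpan ℝ F hY) x.2
    simpa [add_comm] using this
  let f : ℝ → affineSpan ℝ F := fun t => ⟨_, hmem t⟩
  have hf : Continuous f := by
    refine Continuous.subtype_mk ?_ _
    fun_prop
  have hf0 : f 0 = x := Subtype.ext (by simp [f])
  have hev : ∀ᶠ t in nhds (0 : ℝ), f t ∈ ((↑) ⁻¹' F : Set (affineSpan ℝ F)) :=
    hf.continuousAt.eventually_mem (by rw [hf0]; exact mem_interior_iff_mem_nhds.1 hx)
  obtain ⟨δ, hδ, hδ0⟩ :=
    ((hev.filter_mono nhdsWithin_le_nhds).and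
      (self_mem_nhdsWithin : Set.Ioi (0 : ℝ) ∈ nhdsWithin 0 (Set.Ioi 0))).exists
  exact ⟨δ, hδ0, hδ⟩

/-- A face of the rank sparsity ball which contains `0` is the whole ball. -/
lemma IsFace.eq_of_zero_mem {n m : ℕ} {F : Set (Matrix (Fin n) (Fin m) ℝ)}
    (hF : IsFace {X | l1Norm X + nuclearNorm X ≤ 1} F) (h0 : 0 ∈ F) :
    F = {X | l1Norm X + nuclearNorm X ≤ 1} := by
  refine hF.1.antisymm fun Y hY => ?_
  have hY' : l1Norm ((-1 : ℝ) • Y) + nuclearNorm ((-1 : ℝ) • Y) ≤ 1 := by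
    rw [l1Norm_smul, nuclearNorm_smul]
    simpa using hY
  refine (hF.2.2 hY hY' (t := 1 / 2) (by norm_num) (by norm_num) ?_).1
  convert h0 using 1
  module

/-- **Facial exposedness of the rank sparsity ball.**  Every (nonempty) face of
`ℬ_{1,*} = {X : ‖X‖₁ + ‖X‖_* ≤ 1}` is an exposed face. -/
theorem stmt13 {n m : ℕ} (hnm : n ≤ m) :
    ∀ F : Set (Matrix (Fin n) (Fin m) ℝ),
      IsFace {X | l1Norm X + nuclearNorm X ≤ 1} F → F.Nonempty →
      ∃ V : Matrix (Fin n) (Fin m) ℝ,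
        F = {X | (l1Norm X + nuclearNorm X ≤ 1) ∧
          ∀ Y, l1Norm Y + nuclearNorm Y ≤ 1 → mInner V Y ≤ mInner V X} := by
  intro F hF hne
  obtain ⟨X, hXF, hXri⟩ := exists_prolongation_point hF.2.1 hne
  by_cases h0 : (0 : Matrix (Fin n) (Fin m) ℝ) ∈ F
  · refine ⟨0, ?_⟩
    rw [hF.eq_of_zero_mem h0]
    simp [mInner]
  have hX1 : l1Norm X + nuclearNorm X ≤ 1 := hF.1 hXF
  have hXne : X ≠ 0 := fun h => h0 (h ▸ hXF)
  have hpos : 0 < l1Norm X + nuclearNorm X :=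
    add_pos_of_pos_of_nonneg ((l1Norm_nonneg X).lt_of_ne fun h =>
      hXne (eq_zero_of_l1Norm_eq_zero h.symm)) (nuclearNorm_nonneg X)
  have hXeq : l1Norm X + nuclearNorm X = 1 := by
    refine hX1.eq_or_lt.resolve_right fun hlt => h0 ?_
    set r := l1Norm X + nuclearNorm X with hr
    have hz : l1Norm (0 : Matrix (Fin n) (Fin m) ℝ) +
        nuclearNorm (0 : Matrix (Fin n) (Fin m) ℝ) ≤ 1 := by
      have h1 := l1Norm_smul 0 X
      have h2 := nuclearNorm_smul 0 X
      simp only [zero_smul, abs_zero, zero_mul] at h1 h2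
      simp [h1, h2]
    have hs : l1Norm (r⁻¹ • X) + nuclearNorm (r⁻¹ • X) ≤ 1 := by
      rw [l1Norm_smul, nuclearNorm_smul, ← mul_add, ← hr, abs_of_pos (inv_pos.2 hpos),
        inv_mul_cancel₀ hpos.ne']
    refine (hF.2.2 hz hs hpos hlt ?_).1
    rwa [smul_zero, zero_add, smul_smul, mul_inv_cancel₀ hpos.ne', one_smul]
  obtain ⟨V₁, hV₁, hV₁X, hV₁Y⟩ := exists_subgradient_l1Norm X
  obtain ⟨V₂, hV₂, hV₂X, hV₂Y⟩ := exists_subgradient_nuclearNorm X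
  have hle : ∀ Y, mInner (V₁ + V₂) Y ≤ l1Norm Y + nuclearNorm Y := fun Y => by
    rw [mInner_add_left]
    exact add_le_add (hV₁ Y) (hV₂ Y)
  have hVX : mInner (V₁ + V₂) X = 1 := by rw [mInner_add_left, hV₁X, hV₂X, hXeq]
  refine ⟨V₁ + V₂, Set.Subset.antisymm (fun Y hY => ⟨hF.1 hY, fun Z hZ => ?_⟩) ?_⟩
  · obtain ⟨δ, hδ, hmem⟩ := hXri Y hY
    have h1 : mInner (V₁ + V₂) (X + δ • (X - Y)) ≤ 1 := (hle _).trans (hF.1 hmem)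
    rw [mInner_add_right, mInner_smul_right, mInner_sub_right, hVX] at h1
    have h2 : 1 ≤ mInner (V₁ + V₂) Y := by
      by_contra! h
      linarith [mul_pos hδ (sub_pos.2 h)]
    exact ((hle Z).trans hZ).trans h2
  · rintro Y ⟨hY1, hYmax⟩
    have h1 := hYmax X hX1
    have h2 := hV₁ Y
    have h3 := hV₂ Y
    rw [hVX, mInner_add_left] at h1
    obtain ⟨ε₁, hε₁, H₁⟩ := hV₁Y Y (by linarith)
    obtain ⟨ε₂, hε₂, H₂⟩ := hV₂Y Y (by linarith)
    set δ := min ε₁ ε₂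
    have hδ : 0 < δ := lt_min hε₁ hε₂
    have hVY : mInner (V₁ + V₂) Y = 1 := by
      rw [mInner_add_left]
      linarith
    have hZ : l1Norm (X + δ • (X - Y)) + nuclearNorm (X + δ • (X - Y)) ≤ 1 := by
      rw [H₁ δ hδ (min_le_left _ _), H₂ δ hδ (min_le_right _ _), ← mInner_add_left,
        mInner_add_right, mInner_smul_right, mInner_sub_right, hVX, hVY]
      simp
    refine (hF.2.2 hY1 hZ (t := (1 + δ)⁻¹) (by positivity)
      (inv_lt_one_of_one_lt₀ (by linarith)) ?_).1
    have hne' : 1 + δ ≠ 0 := by positivity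
    convert hXF using 1
    ext i j
    simp only [Matrix.add_apply, Matrix.smul_apply, Matrix.sub_apply, smul_eq_mul]
    field_simp
    ring
end
end

section
/- Consider the optimization problem of minimizing ‖X‖₁ + θ‖X‖_* over matrices X ∈ M^{n×m} subject to 𝒜(X) = b, where 𝒜 : M^{n×m} → ℝ^d is a linear operator, b ∈ ℝ^d, and θ > 0. Then any extreme point X̄ of the solution set satisfies r̄(r̄+1)/2 − |Ī| ≤ 1 + d, where r̄ is the rank of X̄ and Ī := {(i,j) : X̄_{ij} = 0} is the index set of zero entries of X̄. Moreover, the same inequality holds with d replaced by the dimension of the range of 𝒜. -/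
noncomputable section

open Set

open Matrix Filter Topology

namespace SparseLowRank

/-- Spectral theorem for real symmetric matrices, in terms of transposes. -/
lemma exists_orthogonal_diagonalization {n : ℕ} {B : Matrix (Fin n) (Fin n) ℝ}
    (hB : B.IsHermitian) :
    ∃ U : Matrix (Fin n) (Fin n) ℝ, Uᵀ * U = 1 ∧ U * Uᵀ = 1 ∧
      B = U * diagonal hB.eigenvalues * Uᵀ := by
  refine ⟨hB.eigenvectorUnitary, ?_, ?_, ?_⟩
  · simpa [star_eq_conjTranspose] using Unitary.coe_star_mul_self hB.eigenvectorUnitary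
  · simpa [star_eq_conjTranspose] using Unitary.coe_mul_star_self hB.eigenvectorUnitary
  · have h := hB.spectral_theorem
    rw [Unitary.conjStarAlgAut_apply] at h
    simpa [star_eq_conjTranspose, Function.comp_def] using h

/-- If `B` is a positive semidefinite square root of `X * Xᵀ`, the nuclear norm of `X` is the
trace of `B`. -/
lemma nuclearNorm_eq_trace {n m : ℕ} {X : Matrix (Fin n) (Fin m) ℝ}
    {B : Matrix (Fin n) (Fin n) ℝ} (hB : B.PosSemidef) (h : X * Xᵀ = B * B) :
    nuclearNorm X = B.trace := by
  obtain ⟨U, hU, -, hBU⟩ := exists_orthogonal_diagonalization hB.isHermitian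
  set ev := hB.isHermitian.eigenvalues
  have hroots : (X * Xᴴ).charpoly.roots = Finset.univ.val.map fun i => ev i ^ 2 := by
    have hsq : X * Xᴴ = U * (diagonal (fun i => ev i ^ 2) * Uᵀ) := by
      rw [conjTranspose_eq_transpose_of_trivial, h, hBU]
      calc U * diagonal ev * Uᵀ * (U * diagonal ev * Uᵀ)
          = U * diagonal ev * (Uᵀ * U) * diagonal ev * Uᵀ := by simp only [Matrix.mul_assoc]
        _ = U * (diagonal ev * diagonal ev) * Uᵀ := by
          rw [hU, Matrix.mul_one]; simp only [Matrix.mul_assoc]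
        _ = _ := by rw [diagonal_mul_diagonal, Matrix.mul_assoc]; simp only [sq]
    rw [hsq, charpoly_mul_comm, Matrix.mul_assoc, hU, Matrix.mul_one, charpoly_diagonal,
      Polynomial.roots_prod _ _
        (Finset.prod_ne_zero_iff.2 fun i _ => Polynomial.X_sub_C_ne_zero _)]
    simp only [Polynomial.roots_X_sub_C, Multiset.bind_singleton]
  have hX := (isHermitian_mul_conjTranspose_self X).roots_charpoly_eq_eigenvalues
  rw [hroots] at hX
  have hsum := congrArg (fun s : Multiset ℝ => (s.map Real.sqrt).sum) hX
  have htrace : B.trace = ∑ i, ev i := by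
    simpa using hB.isHermitian.trace_eq_sum_eigenvalues
  rw [htrace]
  simp only [Multiset.map_map, Function.comp_def, RCLike.ofReal_real_eq_id, id] at hsum
  calc nuclearNorm X = ∑ i, Real.sqrt (ev i ^ 2) := hsum.symm
    _ = ∑ i, ev i := Finset.sum_congr rfl fun i _ => Real.sqrt_sq (hB.eigenvalues_nonneg i)

/-- The direction `U R K R⁻¹ Uᵀ X`, where `R` is the diagonal matrix with entries `ρ`. -/
def direction {n m : ℕ} (X : Matrix (Fin n) (Fin m) ℝ) (U : Matrix (Fin n) (Fin n) ℝ)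
    (ρ : Fin n → ℝ) (K : Matrix (Fin n) (Fin n) ℝ) : Matrix (Fin n) (Fin m) ℝ :=
  U * (diagonal ρ * K * diagonal (fun i => (ρ i)⁻¹)) * Uᵀ * X

/-- Along the directions `direction X U ρ K` with `1 + K` positive semidefinite, the nuclear
norm is affine. -/
lemma nuclearNorm_add_direction {n m : ℕ} {X : Matrix (Fin n) (Fin m) ℝ}
    {U : Matrix (Fin n) (Fin n) ℝ} {ρ : Fin n → ℝ} (hU : Uᵀ * U = 1) (hU' : U * Uᵀ = 1)
    (hX : X * Xᵀ = U * diagonal (fun i => ρ i ^ 4) * Uᵀ) {K : Matrix (Fin n) (Fin n) ℝ}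
    (hK : (1 + K).PosSemidef) :
    nuclearNorm (X + direction X U ρ K) =
      (diagonal ρ * diagonal ρ).trace + (diagonal ρ * K * diagonal ρ).trace := by
  set R := diagonal ρ with hR
  set R' := diagonal (fun i => (ρ i)⁻¹) with hR'
  set T := R * (1 + K) * R with hT
  set M := 1 + R * K * R' with hM
  have hTpos : T.PosSemidef := by
    simpa [hT, hR] using hK.mul_mul_conjTranspose_same R
  have hMT : M * (R * R) = T := by
    have : R' * (R * R) = R := by
      simp only [hR, hR', diagonal_mul_diagonal]
      congr 1; ext i
      by_cases h : ρ i = 0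
      · simp [h]
      · field_simp
    rw [hM, hT, Matrix.add_mul, Matrix.mul_assoc, this]
    simp [Matrix.mul_add, Matrix.add_mul]
  have hTT : Tᵀ = T := by simpa using hTpos.isHermitian.eq
  have hMT' : (R * R) * Mᵀ = T := by
    rw [← hTT, ← hMT]; simp [hR, Matrix.transpose_mul]
  have hD : diagonal (fun i => ρ i ^ 4) = (R * R) * (R * R) := by
    simp only [hR, diagonal_mul_diagonal]
    congr 1; ext i; ring
  have hsum : X + direction X U ρ K = U * M * Uᵀ * X := by
    simp [direction, hM, Matrix.mul_add, Matrix.add_mul, hU', hR, hR']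
  have hpos : (U * T * Uᵀ).PosSemidef := by
    simpa using hTpos.mul_mul_conjTranspose_same U
  have hsq : (X + direction X U ρ K) * (X + direction X U ρ K)ᵀ =
      (U * T * Uᵀ) * (U * T * Uᵀ) := by
    rw [hsum]
    calc U * M * Uᵀ * X * (U * M * Uᵀ * X)ᵀ
        = U * M * Uᵀ * (X * Xᵀ) * (U * Mᵀ * Uᵀ) := by
          simp only [transpose_mul, transpose_transpose, Matrix.mul_assoc]
      _ = U * M * (Uᵀ * U) * (R * R) * (R * R) * (Uᵀ * U) * Mᵀ * Uᵀ := by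
          rw [hX, hD]; simp only [Matrix.mul_assoc]
      _ = U * (M * (R * R)) * ((R * R) * Mᵀ) * Uᵀ := by
          rw [hU]; simp only [Matrix.mul_assoc, Matrix.one_mul]
      _ = U * T * (Uᵀ * U) * T * Uᵀ := by rw [hMT, hMT', hU, Matrix.mul_one]
      _ = _ := by simp only [Matrix.mul_assoc]
  rw [nuclearNorm_eq_trace hpos hsq, Matrix.trace_mul_comm, ← Matrix.mul_assoc, hU,
    Matrix.one_mul, hT]
  simp [Matrix.mul_add, Matrix.add_mul]

/-- Small symmetric perturbations of the identity are positive semidefinite. -/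
lemma eventually_posSemidef_one_add_smul {n : ℕ} {K : Matrix (Fin n) (Fin n) ℝ}
    (hK : K.IsHermitian) : ∀ᶠ t : ℝ in 𝓝 0, (1 + t • K).PosSemidef := by
  obtain ⟨U, -, hU', hKU⟩ := exists_orthogonal_diagonalization hK
  have hev : ∀ᶠ t : ℝ in 𝓝 0, ∀ i, 0 < 1 + t * hK.eigenvalues i := by
    refine eventually_all.2 fun i => ?_
    have hc : Continuous fun t : ℝ => 1 + t * hK.eigenvalues i := by fun_prop
    exact hc.continuousAt.eventually_mem (Ioi_mem_nhds (by simp))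
  filter_upwards [hev] with t ht
  have hdiag : (diagonal fun i => 1 + t * hK.eigenvalues i).PosSemidef :=
    PosSemidef.diagonal fun i => (ht i).le
  have heq : 1 + t • K = U * (diagonal fun i => 1 + t * hK.eigenvalues i) * Uᵀ := by
    have : (diagonal fun i => 1 + t * hK.eigenvalues i) =
        1 + t • diagonal hK.eigenvalues := by
      rw [← diagonal_one, ← diagonal_smul, diagonal_add]; rfl
    conv_lhs => rw [hKU]
    rw [this]
    simp [Matrix.mul_add, Matrix.add_mul, hU']
  rw [heq]
  simpa using hdiag.mul_mul_conjTranspose_same U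

/-- If `W` vanishes at the zero entries of `X`, the entrywise norm is affine near `X` along `W`. -/
lemma eventually_l1Norm_add_add_l1Norm_sub {n m : ℕ} {X W : Matrix (Fin n) (Fin m) ℝ}
    (hW : ∀ i j, X i j = 0 → W i j = 0) :
    ∀ᶠ t : ℝ in 𝓝 0, l1Norm (X + t • W) + l1Norm (X - t • W) = 2 * l1Norm X := by
  have hentry : ∀ᶠ t : ℝ in 𝓝 0, ∀ i j, |t * W i j| ≤ |X i j| := by
    refine eventually_all.2 fun i => eventually_all.2 fun j => ?_
    by_cases h : X i j = 0
    · simp [h, hW i j h]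
    · have hc : Continuous fun t : ℝ => |t * W i j| := by fun_prop
      refine (hc.continuousAt.eventually_mem (Iio_mem_nhds ?_)).mono fun t ht => le_of_lt ht
      simpa using h
  filter_upwards [hentry] with t ht
  simp only [l1Norm, Finset.mul_sum, ← Finset.sum_add_distrib]
  refine Finset.sum_congr rfl fun i _ => Finset.sum_congr rfl fun j _ => ?_
  have h := ht i j
  simp only [Matrix.add_apply, Matrix.sub_apply, Matrix.smul_apply, smul_eq_mul]
  grind

/-- The symmetric matrix determined by a function on unordered pairs of indices in a subset,
extended by zero. -/
def symmetricOfPairs {n : ℕ} (p : Fin n → Prop) :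
    (Sym2 {i // p i} → ℝ) →ₗ[ℝ] Matrix (Fin n) (Fin n) ℝ where
  toFun k := of fun i j => Function.extend (Sym2.map Subtype.val) k 0 s(i, j)
  map_add' k l := by
    ext i j
    simpa using congrFun ((Function.ExtendByZero.linearMap ℝ
      (Sym2.map (Subtype.val : {i // p i} → Fin n))).map_add k l) s(i, j)
  map_smul' c k := by
    ext i j
    simpa using congrFun ((Function.ExtendByZero.linearMap ℝ
      (Sym2.map (Subtype.val : {i // p i} → Fin n))).map_smul c k) s(i, j)

lemma symmetricOfPairs_isHermitian {n : ℕ} {p : Fin n → Prop} (k : Sym2 {i // p i} → ℝ) :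
    (symmetricOfPairs p k).IsHermitian := by
  ext i j
  simp [symmetricOfPairs, Sym2.eq_swap]

lemma symmetricOfPairs_apply_coe {n : ℕ} {p : Fin n → Prop} (k : Sym2 {i // p i} → ℝ)
    (i j : {i // p i}) : symmetricOfPairs p k i j = k s(i, j) :=
  (Sym2.map.injective Subtype.val_injective).extend_apply k 0 s(i, j)

/-- `direction` as a linear map in its last argument. -/
def directionLinear {n m : ℕ} (X : Matrix (Fin n) (Fin m) ℝ) (U : Matrix (Fin n) (Fin n) ℝ)
    (ρ : Fin n → ℝ) : Matrix (Fin n) (Fin n) ℝ →ₗ[ℝ] Matrix (Fin n) (Fin m) ℝ where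
  toFun := direction X U ρ
  map_add' K L := by simp [direction, Matrix.mul_add, Matrix.add_mul]
  map_smul' c K := by simp [direction]

/-- The map from symmetric matrices supported on the nonzero `ρ` to directions is injective. -/
lemma eq_zero_of_direction_eq_zero {n m : ℕ} {X : Matrix (Fin n) (Fin m) ℝ}
    {U : Matrix (Fin n) (Fin n) ℝ} {ρ : Fin n → ℝ} (hU : Uᵀ * U = 1)
    (hX : X * Xᵀ = U * diagonal (fun i => ρ i ^ 4) * Uᵀ) {K : Matrix (Fin n) (Fin n) ℝ}
    (h : direction X U ρ K = 0) {i j : Fin n} (hi : ρ i ≠ 0) (hj : ρ j ≠ 0) : K i j = 0 := by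
  have hprod : diagonal ρ * K * diagonal (fun i => (ρ i)⁻¹) * diagonal (fun i => ρ i ^ 4) = 0 := by
    calc _ = (Uᵀ * U) * (diagonal ρ * K * diagonal (fun i => (ρ i)⁻¹)) * (Uᵀ * U) *
            diagonal (fun i => ρ i ^ 4) * (Uᵀ * U) := by
          rw [hU]; simp
      _ = Uᵀ * (U * (diagonal ρ * K * diagonal (fun i => (ρ i)⁻¹)) * Uᵀ) *
            (U * diagonal (fun i => ρ i ^ 4) * Uᵀ) * U := by
          simp only [Matrix.mul_assoc]
      _ = Uᵀ * direction X U ρ K * Xᵀ * U := by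
          rw [← hX, direction]; simp only [Matrix.mul_assoc]
      _ = 0 := by simp [h]
  have hij := congrFun (congrFun hprod i) j
  simpa [hi, hj] using hij

/-- The sharp form of the bound: a nonzero direction in the kernel of `A` that vanishes at the
zero entries of `X` contradicts extremality. -/
lemma choose_rank_le_ncard_add_finrank_range {n m d : ℕ} {θ : ℝ}
    {A : Matrix (Fin n) (Fin m) ℝ →ₗ[ℝ] (Fin d → ℝ)} {b : Fin d → ℝ}
    {X : Matrix (Fin n) (Fin m) ℝ}
    (hX : X ∈ Set.extremePoints ℝ
      {X | A X = b ∧ ∀ Y, A Y = b →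
        l1Norm X + θ * nuclearNorm X ≤ l1Norm Y + θ * nuclearNorm Y}) :
    (X.rank + 1).choose 2 ≤
      {p : Fin n × Fin m | X p.1 p.2 = 0}.ncard + Module.finrank ℝ (LinearMap.range A) := by
  classical
  have hXX := isHermitian_mul_conjTranspose_self X
  have hrank : X.rank = Fintype.card {i // hXX.eigenvalues i ≠ 0} := by
    rw [← hXX.rank_eq_card_non_zero_eigs, rank_self_mul_conjTranspose]
  obtain ⟨U, hU, hU', hdiag⟩ := exists_orthogonal_diagonalization hXX
  have hnonneg : ∀ i, 0 ≤ hXX.eigenvalues i :=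
    (posSemidef_self_mul_conjTranspose X).eigenvalues_nonneg
  set ev := hXX.eigenvalues
  set ρ : Fin n → ℝ := fun i => √√(ev i)
  have hρ4 : ∀ i, ρ i ^ 4 = ev i := fun i => by
    rw [show ρ i ^ 4 = (√√(ev i) ^ 2) ^ 2 by ring, Real.sq_sqrt (Real.sqrt_nonneg _),
      Real.sq_sqrt (hnonneg i)]
  have hdec : X * Xᵀ = U * diagonal (fun i => ρ i ^ 4) * Uᵀ := by
    simpa [hρ4] using hdiag
  by_contra! hlt
  let Z := {p : Fin n × Fin m | X p.1 p.2 = 0}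
  let L := directionLinear X U ρ ∘ₗ symmetricOfPairs (fun i => ev i ≠ 0)
  let restrict : Matrix (Fin n) (Fin m) ℝ →ₗ[ℝ] (Z → ℝ) :=
    LinearMap.pi fun p => Matrix.entryLinearMap ℝ ℝ p.1.1 p.1.2
  let Φ := (restrict.prod A.rangeRestrict) ∘ₗ L
  obtain ⟨k, hk, hk0⟩ : ∃ k ∈ LinearMap.ker Φ, k ≠ 0 := by
    refine (Submodule.ne_bot_iff _).1 (LinearMap.ker_ne_bot_of_finrank_lt ?_)
    rwa [Module.finrank_prod, Module.finrank_fintype_fun_eq_card,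
      Module.finrank_fintype_fun_eq_card, Sym2.card, ← hrank, ← Nat.card_eq_fintype_card]
  set K := symmetricOfPairs (fun i => ev i ≠ 0) k
  set W := direction X U ρ K
  have hΦ : restrict W = 0 ∧ A.rangeRestrict W = 0 := by
    have h : (restrict W, A.rangeRestrict W) = 0 := hk
    exact Prod.mk_eq_zero.1 h
  have hWZ : ∀ i j, X i j = 0 → W i j = 0 := fun i j hij => congrFun hΦ.1 ⟨(i, j), hij⟩
  have hAW : A W = 0 := congrArg Subtype.val hΦ.2
  have hW0 : W ≠ 0 := by
    refine fun hW => hk0 (funext fun z => ?_)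
    induction z with | h i j => ?_
    have hpos : ∀ i : {i // ev i ≠ 0}, ρ i ≠ 0 := fun i h =>
      i.2 (by rw [← hρ4, h]; simp)
    refine (symmetricOfPairs_apply_coe k i j).symm.trans ?_
    exact eq_zero_of_direction_eq_zero hU hdec hW (hpos i) (hpos j)
  have hKH : K.IsHermitian := symmetricOfPairs_isHermitian k
  have hnuc : ∀ {c : ℝ}, (1 + c • K).PosSemidef → nuclearNorm (X + c • W) =
      (diagonal ρ * diagonal ρ).trace + c * (diagonal ρ * K * diagonal ρ).trace := fun {c} hc => by
    have h := nuclearNorm_add_direction hU hU' hdec hc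
    have hsmul : direction X U ρ (c • K) = c • W := (directionLinear X U ρ).map_smul c K
    rw [hsmul] at h
    simpa using h
  have hneg : ∀ᶠ t : ℝ in 𝓝 0, (1 + (-t) • K).PosSemidef :=
    (continuous_neg.tendsto' (0 : ℝ) 0 neg_zero).eventually
      (eventually_posSemidef_one_add_smul hKH)
  have hsmall := (eventually_posSemidef_one_add_smul hKH).and
    (hneg.and (eventually_l1Norm_add_add_l1Norm_sub hWZ))
  obtain ⟨t, ⟨hpos, hneg, hl1⟩, ht⟩ :=
    ((hsmall.filter_mono nhdsWithin_le_nhds).and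
      (self_mem_nhdsWithin : Set.Ioi (0 : ℝ) ∈ 𝓝[>] 0)).exists
  have hn0 : nuclearNorm X = (diagonal ρ * diagonal ρ).trace := by
    simpa using hnuc (c := 0) (by simpa using PosSemidef.one)
  have hn1 := hnuc hpos
  have hn2 := hnuc hneg
  rw [neg_smul, ← sub_eq_add_neg] at hn2
  obtain ⟨⟨hAX, hmin⟩, hext⟩ := hX
  have hA1 : A (X + t • W) = b := by simp [hAX, hAW]
  have hA2 : A (X - t • W) = b := by simp [hAX, hAW]
  have hm1 := hmin _ hA1
  have hm2 := hmin _ hA2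
  have hmid : l1Norm (X + t • W) + θ * nuclearNorm (X + t • W) +
      (l1Norm (X - t • W) + θ * nuclearNorm (X - t • W)) =
      2 * (l1Norm X + θ * nuclearNorm X) := by
    rw [hn1, hn2, hn0]; linear_combination hl1
  have hseg : X ∈ openSegment ℝ (X + t • W) (X - t • W) :=
    ⟨1 / 2, 1 / 2, by norm_num, by norm_num, by norm_num, by module⟩
  have heq := hext ⟨hA1, fun Y hY => by linarith [hmin Y hY]⟩
    ⟨hA2, fun Y hY => by linarith [hmin Y hY]⟩ hseg
  have : t • W = 0 := by simpa using heq
  exact (smul_ne_zero (ne_of_gt ht) hW0) this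

end SparseLowRank

/-- **Sparse low rank solutions of a linear system.**  Any extreme point `X̄` of the set of
minimizers of `‖X‖₁ + θ‖X‖_*` over `{X : 𝒜(X) = b}` satisfies
`r̄(r̄+1)/2 − |Ī| ≤ 1 + d`, where `r̄ = rank X̄` and `Ī` is the set of zero entries of `X̄`;
the same holds with `d` replaced by the dimension of the range of `𝒜`. -/
theorem stmt15 {n m d : ℕ} (hnm : n ≤ m) (θ : ℝ) (hθ : 0 < θ)
    (A : Matrix (Fin n) (Fin m) ℝ →ₗ[ℝ] (Fin d → ℝ)) (b : Fin d → ℝ)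
    (Xb : Matrix (Fin n) (Fin m) ℝ)
    (hXb : Xb ∈ Set.extremePoints ℝ
      {X | A X = b ∧ ∀ Y, A Y = b →
        l1Norm X + θ * nuclearNorm X ≤ l1Norm Y + θ * nuclearNorm Y}) :
    ((Xb.rank : ℤ) * (Xb.rank + 1)) / 2
        - ({p : Fin n × Fin m | Xb p.1 p.2 = 0}.ncard : ℤ) ≤ 1 + (d : ℤ) ∧
    ((Xb.rank : ℤ) * (Xb.rank + 1)) / 2
        - ({p : Fin n × Fin m | Xb p.1 p.2 = 0}.ncard : ℤ)
      ≤ 1 + (Module.finrank ℝ (LinearMap.range A) : ℤ) := by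
  have hcard := SparseLowRank.choose_rank_le_ncard_add_finrank_range hXb
  rw [Nat.choose_two_right, Nat.add_sub_cancel, mul_comm] at hcard
  have hrange : Module.finrank ℝ (LinearMap.range A) ≤ d := by
    simpa using Submodule.finrank_le (LinearMap.range A)
  have hcast : ((Xb.rank : ℤ) * (Xb.rank + 1)) / 2 = ((Xb.rank * (Xb.rank + 1) / 2 : ℕ) : ℤ) := by
    push_cast; rfl
  rw [hcast]
  constructor <;> omega
end
end

section
/- Let K ⊆ E be a closed convex cone in a finite-dimensional real inner product space E and let x̄ ∈ K. Set F := N_K(x̄). Then F is an exposed face of the polar cone K°, and for every v̄ ∈ F, the equality N_F(v̄) ∩ K = N_{K°}(v̄) holds. -/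
noncomputable section

open Set
open scoped RealInnerProductSpace

/-- The normal cone to `Q` at `xbar`. -/
def NormalCone {E : Type*} [NormedAddCommGroup E] [InnerProductSpace ℝ E]
    (Q : Set E) (xbar : E) : Set E :=
  {v | ∀ x ∈ Q, ⟪v, x - xbar⟫ ≤ 0}

/-- The polar cone `K° = {v : ⟨v, x⟩ ≤ 0 for all x ∈ K}`. -/
def PolarCone {E : Type*} [NormedAddCommGroup E] [InnerProductSpace ℝ E] (K : Set E) : Set E :=
  {v | ∀ x ∈ K, ⟪v, x⟫ ≤ 0}

/-- The normal cone to a cone `K` at `x ∈ K` is the part of the polar cone orthogonal to `x`. -/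
theorem mem_normalCone_iff_of_cone {E : Type*} [NormedAddCommGroup E] [InnerProductSpace ℝ E]
    {K : Set E} (hK : ∀ x ∈ K, ∀ c : ℝ, 0 ≤ c → c • x ∈ K) {x v : E} (hx : x ∈ K) :
    v ∈ NormalCone K x ↔ v ∈ PolarCone K ∧ ⟪v, x⟫ = 0 := by
  constructor
  · intro hv
    have h0 := hv _ (hK x hx 0 le_rfl)
    have h2 := hv _ (hK x hx 2 zero_le_two)
    simp only [inner_sub_right, inner_smul_right] at h0 h2
    have hvx : ⟪v, x⟫ = 0 := by linarith
    refine ⟨fun y hy => ?_, hvx⟩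
    have := hv y hy
    rwa [inner_sub_right, hvx, sub_zero] at this
  · rintro ⟨hv, hvx⟩ y hy
    rw [inner_sub_right, hvx, sub_zero]
    exact hv y hy

theorem zero_mem_polarCone {E : Type*} [NormedAddCommGroup E] [InnerProductSpace ℝ E]
    (K : Set E) : (0 : E) ∈ PolarCone K :=
  fun x _ => (inner_zero_left x).le

theorem smul_mem_polarCone {E : Type*} [NormedAddCommGroup E] [InnerProductSpace ℝ E]
    (K : Set E) : ∀ v ∈ PolarCone K, ∀ c : ℝ, 0 ≤ c → c • v ∈ PolarCone K := by
  intro v hv c hc x hx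
  rw [real_inner_smul_left]
  exact mul_nonpos_of_nonneg_of_nonpos hc (hv x hx)

/-- The bipolar theorem for closed convex cones. -/
theorem polarCone_polarCone {E : Type*} [NormedAddCommGroup E] [InnerProductSpace ℝ E]
    [CompleteSpace E] {K : Set E} (hclosed : IsClosed K) (hconv : Convex ℝ K)
    (hcone : ∀ x ∈ K, ∀ c : ℝ, 0 ≤ c → c • x ∈ K) (hne : K.Nonempty) :
    PolarCone (PolarCone K) = K := by
  refine Subset.antisymm (fun w hw => ?_) fun x hx v hv => ?_
  · by_contra hwK
    obtain ⟨f, u, hfu, huw⟩ := geometric_hahn_banach_closed_point hconv hclosed hwK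
    have hu : 0 < u := by
      obtain ⟨x, hx⟩ := hne
      simpa using hfu _ (hcone x hx 0 le_rfl)
    have hf : (InnerProductSpace.toDual ℝ E).symm f ∈ PolarCone K := by
      intro x hx
      rw [InnerProductSpace.toDual_symm_apply]
      by_contra! hpos
      have := hfu _ (hcone x hx (u / f x) (by positivity))
      rw [map_smul, smul_eq_mul, div_mul_cancel₀ _ hpos.ne'] at this
      exact this.false
    have := hw _ hf
    rw [real_inner_comm, InnerProductSpace.toDual_symm_apply] at this
    linarith
  · rw [real_inner_comm]
    exact hv x hx

/-- **Exposed faces of the dual cone.**  For a closed convex cone `K` and `xbar ∈ K`, the set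
`F := N_K(xbar)` is an exposed face of `K°`, and `N_F(vbar) ∩ K = N_{K°}(vbar)` for every `vbar ∈ F`. -/
theorem stmt19 {E : Type*} [NormedAddCommGroup E] [InnerProductSpace ℝ E]
    [FiniteDimensional ℝ E] (K : Set E) (hKclosed : IsClosed K) (hKconv : Convex ℝ K)
    (hKcone : ∀ x ∈ K, ∀ c : ℝ, 0 ≤ c → c • x ∈ K) (xbar : E) (hxbar : xbar ∈ K) :
    (∃ v : E, NormalCone K xbar =
      {w ∈ PolarCone K | ∀ y ∈ PolarCone K, ⟪v, y⟫ ≤ ⟪v, w⟫}) ∧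
    ∀ vbar ∈ NormalCone K xbar,
      NormalCone (NormalCone K xbar) vbar ∩ K = NormalCone (PolarCone K) vbar := by
  have hN : ∀ v, v ∈ NormalCone K xbar ↔ v ∈ PolarCone K ∧ ⟪v, xbar⟫ = 0 :=
    fun v => mem_normalCone_iff_of_cone hKcone hxbar
  refine ⟨⟨xbar, ?_⟩, fun vbar hvbar => ?_⟩
  · ext w
    rw [hN, mem_sep_iff]
    refine and_congr_right fun hw => ⟨fun h y hy => ?_, fun h => ?_⟩
    · rw [real_inner_comm, real_inner_comm w, h]
      exact hy xbar hxbar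
    · have h0 := h 0 (zero_mem_polarCone K)
      rw [inner_zero_right, real_inner_comm] at h0
      exact le_antisymm (hw xbar hxbar) h0
  · have hFcone : ∀ v ∈ NormalCone K xbar, ∀ c : ℝ, 0 ≤ c → c • v ∈ NormalCone K xbar := by
      intro v hv c hc
      rw [hN] at hv ⊢
      exact ⟨smul_mem_polarCone K v hv.1 c hc, by rw [real_inner_smul_left, hv.2, mul_zero]⟩
    ext w
    rw [mem_inter_iff, mem_normalCone_iff_of_cone hFcone hvbar,
      mem_normalCone_iff_of_cone (smul_mem_polarCone K) ((hN vbar).1 hvbar).1,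
      polarCone_polarCone hKclosed hKconv hKcone ⟨xbar, hxbar⟩]
    refine ⟨fun h => ⟨h.2, h.1.2⟩, fun h => ⟨⟨fun v hv => ?_, h.2⟩, h.1⟩⟩
    rw [real_inner_comm]
    exact ((hN v).1 hv).1 w h.1
end
end
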